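/- Let n ≥ 2 be an integer, p a prime, and 0 < κ < 1. Then there exist constants C₀, C₁, C₂ > 0 depending only on n, p, κ with the following property: for every real θ with 0 ≤ θ ≤ (n+1)/3 and every ball B = B(x₀, r) ⊆ ℤ_p, one has, for all sufficiently large Q, μ( ⋃_{α ∈ 𝔸} B(α, C₀ Q^{−n−1+2θ}) ∩ B ) ≥ κ μ(B), where 𝔸 = 𝔸_n(Q, θ, C₀, C₁, C₂) is the set of α ∈ ℤ_p for which there exists an irreducible polynomial P ∈ ℤ[X] of degree n with P(α) = 0 and C₁ Q ≤ H(P) ≤ C₂ Q, such that P has a root β in the algebraic closure of ℚ_p with 0 < |α − β|_p ≤ C₀ Q^{−θ}. -/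

import Mathlib

open Polynomial MeasureTheory

noncomputable instance (p : ℕ) [Fact p.Prime] : MeasurableSpace ℚ_[p] := borel _
instance (p : ℕ) [Fact p.Prime] : BorelSpace ℚ_[p] := ⟨rfl⟩

/-- The height of an integer polynomial: the maximum of the absolute values of its
coefficients. -/
def polyHeight (P : Polynomial ℤ) : ℕ :=
  (Finset.range (P.natDegree + 1)).sup fun i => (P.coeff i).natAbs


section Balls

variable {p : ℕ} [Fact p.Prime]

/-- The ball of radius `p ^ (-j)` around `x` in `ℚ_[p]`. -/
def pball (x : ℚ_[p]) (j : ℕ) : Set ℚ_[p] := Metric.closedBall x ((p : ℝ) ^ (-(j : ℤ)))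

lemma mem_pball {x y : ℚ_[p]} {j : ℕ} : y ∈ pball x j ↔ ‖y - x‖ ≤ (p : ℝ) ^ (-(j : ℤ)) := by
  simp [pball, dist_eq_norm]

lemma self_mem_pball (x : ℚ_[p]) (j : ℕ) : x ∈ pball x j := by
  rw [mem_pball]; simp

lemma one_lt_prime_cast : (1 : ℝ) < p := mod_cast (Fact.out : p.Prime).one_lt

lemma prime_cast_pos : (0 : ℝ) < p := mod_cast (Fact.out : p.Prime).pos

lemma pball_anti (x : ℚ_[p]) {i j : ℕ} (h : i ≤ j) : pball x j ⊆ pball x i := by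
  apply Metric.closedBall_subset_closedBall
  exact zpow_le_zpow_right₀ one_lt_prime_cast.le (by omega)

lemma pball_eq {x y : ℚ_[p]} {j : ℕ} (h : y ∈ pball x j) : pball y j = pball x j :=
  (IsUltrametricDist.closedBall_eq_of_mem h).symm

lemma isOpen_pball (x : ℚ_[p]) (j : ℕ) : IsOpen (pball x j) :=
  IsUltrametricDist.isOpen_closedBall x (zpow_ne_zero _ prime_cast_pos.ne')

lemma measurableSet_pball (x : ℚ_[p]) (j : ℕ) : MeasurableSet (pball x j) :=
  (isOpen_pball x j).measurableSet

variable (μ : Measure ℚ_[p]) [μ.IsAddHaarMeasure]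

lemma measure_pball_zero (x : ℚ_[p]) (j : ℕ) : μ (pball x j) = μ (pball 0 j) := by
  have : pball x j = (fun y => -x + y) ⁻¹' pball 0 j := by
    ext y; simp [mem_pball]; rw [neg_add_eq_sub]
  rw [this, measure_preimage_add]

lemma pball_zero_eq_iUnion (j : ℕ) :
    pball (0 : ℚ_[p]) j = ⋃ i : Fin p, pball ((i : ℕ) * (p : ℚ_[p]) ^ j : ℚ_[p]) (j + 1) := by
  have hp0 : (p : ℚ_[p]) ≠ 0 := by exact_mod_cast (Fact.out : p.Prime).ne_zero
  ext y
  simp only [Set.mem_iUnion]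
  constructor
  · intro hy
    rw [mem_pball, sub_zero] at hy
    have hz : ‖y * ((p : ℚ_[p]) ^ j)⁻¹‖ ≤ 1 := by
      rw [norm_mul, norm_inv, norm_pow, Padic.norm_p, ← div_eq_mul_inv]
      apply div_le_one_of_le₀ _ (by positivity)
      simpa using hy
    let z : ℤ_[p] := ⟨_, hz⟩
    obtain ⟨i, hi, hi'⟩ := PadicInt.exists_mem_range z
    refine ⟨⟨i, hi⟩, ?_⟩
    have h2 : ‖z - i‖ ≤ (p : ℝ) ^ (-(1 : ℕ) : ℤ) := by
      rw [PadicInt.norm_le_pow_iff_mem_span_pow]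
      rw [PadicInt.maximalIdeal_eq_span_p] at hi'
      simpa using hi'
    rw [mem_pball]
    have h3 : y - ((i : ℕ) : ℚ_[p]) * p ^ j = (y * ((p : ℚ_[p]) ^ j)⁻¹ - i) * p ^ j := by
      field_simp
    have h4 : ‖y * ((p : ℚ_[p]) ^ j)⁻¹ - i‖ ≤ (p : ℝ) ^ (-(1 : ℕ) : ℤ) := by
      rw [PadicInt.norm_def] at h2
      simpa using h2
    simp only
    rw [h3, norm_mul, norm_pow, Padic.norm_p]
    calc _ ≤ (p : ℝ) ^ (-(1 : ℕ) : ℤ) * (p : ℝ)⁻¹ ^ j := by gcongr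
      _ = _ := by
        rw [inv_pow, ← zpow_natCast, ← zpow_neg, ← zpow_add₀ prime_cast_pos.ne']
        congr 1; push_cast; ring
  · rintro ⟨i, hi⟩
    have hi := pball_anti _ (Nat.le_succ j) hi
    have h0 : ((i : ℕ) * (p : ℚ_[p]) ^ j : ℚ_[p]) ∈ pball (0 : ℚ_[p]) j := by
      rw [mem_pball, sub_zero, norm_mul, norm_pow, Padic.norm_p, inv_pow, zpow_neg, zpow_natCast]
      exact mul_le_of_le_one_left (by positivity) (by simpa using Padic.norm_int_le_one (p := p) (i : ℕ))
    rwa [pball_eq h0] at hi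

lemma measure_pball_succ (x : ℚ_[p]) (j : ℕ) :
    μ (pball x j) = p * μ (pball x (j + 1)) := by
  rw [measure_pball_zero μ x j, measure_pball_zero μ x (j+1), pball_zero_eq_iUnion, measure_iUnion]
  · simp_rw [measure_pball_zero μ _ (j+1)]
    simp
  · intro i k hik
    rw [Function.onFun, Set.disjoint_left]
    intro y hy hy'
    have h1 : ((i : ℕ) * (p : ℚ_[p]) ^ j : ℚ_[p]) ∈ pball ((k : ℕ) * (p : ℚ_[p]) ^ j : ℚ_[p]) (j + 1) := by
      rw [← pball_eq hy', pball_eq hy]; exact self_mem_pball _ _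
    rw [mem_pball, ← sub_mul, norm_mul, norm_pow, Padic.norm_p] at h1
    have h2 : ‖(((i : ℕ) - (k : ℕ) : ℤ) : ℚ_[p])‖ < 1 := by
      push_cast
      have h3 : (p : ℝ) ^ (-((j + 1 : ℕ) : ℤ)) = (p : ℝ)⁻¹ * (p : ℝ)⁻¹ ^ j := by
        rw [zpow_neg, zpow_natCast, ← inv_pow, pow_succ']
      rw [h3] at h1
      exact (le_of_mul_le_mul_right h1 (by have := prime_cast_pos (p := p); positivity)).trans_lt (inv_lt_one_of_one_lt₀ one_lt_prime_cast)
    rw [Padic.norm_intCast_lt_one_iff] at h2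
    apply hik
    have := Int.eq_zero_of_abs_lt_dvd h2 (by rw [abs_lt]; have := i.2; have := k.2; omega)
    ext; omega
  · intro i; exact measurableSet_pball _ _

lemma measure_pball_add (x : ℚ_[p]) (j i : ℕ) :
    μ (pball x j) = p ^ i * μ (pball x (j + i)) := by
  induction i with
  | zero => simp
  | succ i ih => rw [ih, measure_pball_succ, ← mul_assoc, pow_succ, add_assoc]

end Balls

section Good

variable {p : ℕ} [Fact p.Prime]

lemma card_le_of_separated {f : ℚ_[p][X]} {d i j : ℕ} (hf : f.natDegree ≤ d) {x y₀ : ℚ_[p]}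
    (hy₀ : y₀ ∈ pball x j) {t : Finset ℚ_[p]} (ht : ∀ y ∈ t, y ∈ pball x j)
    (hsep : ∀ y ∈ t, ∀ z ∈ t, y ≠ z → y ∉ pball z (j + i))
    (hsmall : ∀ y ∈ t, ‖f.eval y‖ * (p : ℝ) ^ (i * d) < ‖f.eval y₀‖) : t.card ≤ d := by
  classical
  by_contra! hcard
  obtain ⟨t', ht', hcard'⟩ := Finset.exists_subset_card_eq (show d + 1 ≤ t.card from hcard)
  have h_interp := Lagrange.eq_interpolate (f := f) (s := t') (v := id) Function.injective_id.injOn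
    (by rw [hcard']; exact (Polynomial.degree_le_of_natDegree_le hf).trans_lt (by exact_mod_cast Nat.lt_succ_self d))
  have heval : f.eval y₀ = ∑ y ∈ t', f.eval y * (Lagrange.basis t' id y).eval y₀ := by
    conv_lhs => rw [h_interp, Lagrange.interpolate_apply]
    simp [eval_finsetSum]
  have hne : t'.Nonempty := by rw [← Finset.card_pos]; omega
  obtain ⟨y, hy, hle⟩ := IsUltrametricDist.exists_norm_finsetSum_le_of_nonempty hne
    (fun y => f.eval y * (Lagrange.basis t' id y).eval y₀)
  rw [← heval, norm_mul] at hle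
  have hb : ‖(Lagrange.basis t' id y).eval y₀‖ ≤ (p : ℝ) ^ (i * d) := by
    rw [Lagrange.basis, eval_prod, norm_prod]
    have hc : (t'.erase y).card = d := by rw [Finset.card_erase_of_mem hy]; omega
    calc _ ≤ ∏ _z ∈ t'.erase y, (p : ℝ) ^ i := by
          apply Finset.prod_le_prod
          · intros; positivity
          · intro z hz
            rw [Lagrange.basisDivisor]
            simp only [id, eval_mul, eval_C, eval_sub, eval_X, norm_mul, norm_inv]
            have hyz : y ≠ z := (Finset.ne_of_mem_erase hz).symm
            have hz' := Finset.mem_of_mem_erase hz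
            have h1 := hsep y (ht' hy) z (ht' hz') hyz
            rw [mem_pball, not_le] at h1
            have h2 : ‖y₀ - z‖ ≤ (p : ℝ) ^ (-(j : ℤ)) := by
              rw [← mem_pball, pball_eq (ht z (ht' hz'))]; exact hy₀
            have hpos : 0 < ‖y - z‖ := norm_pos_iff.2 (sub_ne_zero.2 hyz)
            rw [inv_mul_le_iff₀ hpos]
            refine h2.trans ?_
            calc _ = (p : ℝ) ^ (-((j + i : ℕ) : ℤ)) * (p : ℝ) ^ i := by
                  rw [← zpow_natCast (p : ℝ) i, ← zpow_add₀ prime_cast_pos.ne']; congr 1; push_cast; ring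
              _ ≤ _ := by gcongr
      _ = _ := by rw [Finset.prod_const, hc, pow_mul]
  have := hsmall y (ht' hy)
  have h3 : ‖f.eval y‖ * ‖(Lagrange.basis t' id y).eval y₀‖ ≤ ‖f.eval y‖ * (p : ℝ) ^ (i * d) := by
    gcongr
  linarith

variable (μ : Measure ℚ_[p]) [μ.IsAddHaarMeasure]

lemma measure_small_le {f : ℚ_[p][X]} {d : ℕ} (i : ℕ) {j : ℕ} (hf : f.natDegree ≤ d) {x y₀ : ℚ_[p]}
    (hy₀ : y₀ ∈ pball x j) :
    μ {y ∈ pball x j | ‖f.eval y‖ * (p : ℝ) ^ (i * d) < ‖f.eval y₀‖} ≤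
      d * μ (pball x (j + i)) := by
  classical
  set S := {y ∈ pball x j | ‖f.eval y‖ * (p : ℝ) ^ (i * d) < ‖f.eval y₀‖} with hS
  let good : ℕ → Prop := fun k => ∃ t : Finset ℚ_[p], t.card = k ∧ (∀ y ∈ t, y ∈ S) ∧
    ∀ y ∈ t, ∀ z ∈ t, y ≠ z → y ∉ pball z (j + i)
  have hbd : ∀ k, good k → k ≤ d := by
    rintro k ⟨t, rfl, h1, h2⟩
    exact card_le_of_separated hf hy₀ (fun y hy => (h1 y hy).1) h2 (fun y hy => (h1 y hy).2)
  have h0 : good 0 := ⟨∅, rfl, by simp, by simp⟩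
  have hm := Nat.findGreatest_spec (P := good) (Nat.zero_le d) h0
  have hmax : ∀ k, good k → k ≤ Nat.findGreatest good d := fun k hk =>
    Nat.le_findGreatest (hbd k hk) hk
  obtain ⟨t, htc, h1, h2⟩ := hm
  have hcov : S ⊆ ⋃ y ∈ t, pball y (j + i) := by
    intro z hz
    by_contra hz'
    simp only [Set.mem_iUnion, not_exists] at hz'
    have hzt : z ∉ t := fun h => hz' z h (self_mem_pball _ _)
    have := hmax (t.card + 1) ⟨insert z t, Finset.card_insert_of_notMem hzt, ?_, ?_⟩
    · omega
    · intro y hy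
      rcases Finset.mem_insert.1 hy with rfl | hy
      exacts [hz, h1 y hy]
    · intro y hy w hw hyw
      rcases Finset.mem_insert.1 hy with hy1 | hy1 <;> rcases Finset.mem_insert.1 hw with hw1 | hw1
      · exact absurd (hy1.trans hw1.symm) hyw
      · rw [hy1]; exact hz' w hw1
      · intro h
        apply hz' y hy1
        rw [pball_eq h, hw1]; exact self_mem_pball _ _
      · exact h2 y hy1 w hw1 hyw
  calc μ S ≤ μ (⋃ y ∈ t, pball y (j + i)) := measure_mono hcov
    _ ≤ ∑ y ∈ t, μ (pball y (j + i)) := measure_biUnion_finset_le _ _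
    _ = t.card * μ (pball x (j + i)) := by
      rw [Finset.sum_congr rfl (fun y _ => (measure_pball_zero μ y _).trans (measure_pball_zero μ x _).symm)]
      simp
    _ ≤ _ := by
      gcongr
      exact card_le_of_separated hf hy₀ (fun y hy => (h1 y hy).1) h2 (fun y hy => (h1 y hy).2)

end Good

section Nondivergence

variable {p : ℕ} [Fact p.Prime] {ι : Type*} [PartialOrder ι]

/-- A point `x` is marked by `S` if some chain `F ⊆ S` has `ε ≤ ψ s x ≤ 1` on `F`, while
`1 ≤ ψ s x` for all other elements of `S` comparable with every element of `F`. -/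
def IsMarked (ψ : ι → ℚ_[p] → ℝ) (ε : ℝ) (S : Set ι) (x : ℚ_[p]) : Prop :=
  ∃ F ⊆ S, (∀ s ∈ F, ∀ t ∈ F, s ≤ t ∨ t ≤ s) ∧ (∀ s ∈ F, ε ≤ ψ s x ∧ ψ s x ≤ 1) ∧
    ∀ t ∈ S, t ∉ F → (∀ s ∈ F, s ≤ t ∨ t ≤ s) → 1 ≤ ψ t x

variable (μ : Measure ℚ_[p]) [μ.IsAddHaarMeasure]

theorem measure_not_isMarked_le {rk : ι → ℕ} (hrk : StrictMono rk) {ψ : ι → ℚ_[p] → ℝ}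
    (hψ : ∀ s, IsClosed {x | 1 ≤ ψ s x}) {ε : ℝ} {η : ENNReal}
    (good : ∀ s x j, (∃ y ∈ pball x j, 1 ≤ ψ s y) →
      μ {y ∈ pball x j | ψ s y < ε} ≤ η * μ (pball x j))
    (k : ℕ) : ∀ (R : Finset ℕ), R.card = k → ∀ (S : Set ι), (∀ s ∈ S, rk s ∈ R) → ∀ x j,
      (∀ s ∈ S, ∃ y ∈ pball x j, 1 ≤ ψ s y) →
      μ {y ∈ pball x j | ¬ IsMarked ψ ε S y} ≤ (k * p ^ k : ℕ) * η * μ (pball x j) := by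
  classical
  induction k with
  | zero =>
    intro R hR S hS x j _
    have hS0 : ∀ s, s ∉ S := fun s hs => by
      have := hS s hs
      rw [Finset.card_eq_zero.1 hR] at this
      simp at this
    have : {y ∈ pball x j | ¬ IsMarked ψ ε S y} = ∅ := by
      ext y
      simp only [Set.mem_ofPred_eq, Set.mem_empty_iff_false, iff_false, not_and, not_not]
      intro _
      exact ⟨∅, by simp, by simp, by simp, fun t ht => absurd ht (hS0 t)⟩
    rw [this]; simp
  | succ k ih =>
    intro R hR S hS x j hsup
    set c : ENNReal := (k * p ^ k : ℕ) * η with hc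
    -- a ball all of whose points have one function below `1`, with the parent ball good
    have key : ∀ z i, (∀ s ∈ S, ∃ y ∈ pball z i, 1 ≤ ψ s y) →
        (∃ s ∈ S, ∀ y ∈ pball z (i + 1), ψ s y < 1) →
        μ {y ∈ pball z (i + 1) | ¬ IsMarked ψ ε S y} ≤
          ((k + 1) * p ^ (k + 1) : ℕ) * η * μ (pball z (i + 1)) := by
      rintro z i hz ⟨s, hs, hlt⟩
      set S' := {t ∈ S | (s ≤ t ∨ t ≤ s) ∧ t ≠ s} with hS'
      have h1 := ih (R.erase (rk s)) (by rw [Finset.card_erase_of_mem (hS s hs)]; omega) S' (by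
        rintro t ⟨ht, hst, hne⟩
        refine Finset.mem_erase.2 ⟨?_, hS t ht⟩
        rcases hst with h | h
        · exact (hrk (lt_of_le_of_ne h hne.symm)).ne'
        · exact (hrk (lt_of_le_of_ne h hne)).ne) z i (fun t ht => hz t ht.1)
      have h2 := good s z i (hz s hs)
      have hsub : {y ∈ pball z (i + 1) | ¬ IsMarked ψ ε S y} ⊆
          {y ∈ pball z i | ¬ IsMarked ψ ε S' y} ∪ {y ∈ pball z i | ψ s y < ε} := by
        rintro y ⟨hy, hnm⟩
        have hy' := pball_anti z (Nat.le_succ i) hy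
        by_contra hcon
        simp only [Set.mem_union, Set.mem_ofPred_eq, not_or, not_and, not_not, not_lt] at hcon
        obtain ⟨F, hFS, hch, hF1, hF2⟩ := hcon.1 hy'
        apply hnm
        refine ⟨insert s F, ?_, ?_, ?_, ?_⟩
        · exact Set.insert_subset hs (fun t ht => (hFS ht).1)
        · rintro a (rfl | ha) b (rfl | hb)
          · exact Or.inl le_rfl
          · exact (hFS hb).2.1
          · exact (hFS ha).2.1.symm
          · exact hch a ha b hb
        · rintro a (rfl | ha)
          · exact ⟨hcon.2 hy', (hlt y hy).le⟩
          · exact hF1 a ha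
        · intro t ht htF hcomp
          rw [Set.mem_insert_iff, not_or] at htF
          exact hF2 t ⟨ht, hcomp s (Set.mem_insert _ _), htF.1⟩ htF.2
            (fun a ha => hcomp a (Set.mem_insert_of_mem _ ha))
      calc _ ≤ c * μ (pball z i) + η * μ (pball z i) :=
            (measure_mono hsub).trans ((measure_union_le _ _).trans (add_le_add h1 h2))
        _ = ((k * p ^ k + 1) * p : ℕ) * η * μ (pball z (i + 1)) := by
            rw [measure_pball_succ μ z i, hc]; push_cast; ring
        _ ≤ _ := by
            have h3 : (k * p ^ k + 1) * p ≤ (k + 1) * p ^ (k + 1) := by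
              have : 1 ≤ p ^ k := Nat.one_le_pow _ _ (Fact.out : p.Prime).pos
              calc (k * p ^ k + 1) * p ≤ (k * p ^ k + p ^ k) * p := by gcongr
                _ = _ := by ring
            exact mul_le_mul' (mul_le_mul' (Nat.cast_le.2 h3) le_rfl) le_rfl
    -- stopping level
    let st : ℚ_[p] → ℕ → Prop := fun y i => j ≤ i ∧ ∃ s ∈ S, ∀ w ∈ pball y (i + 1), ψ s w < 1
    let 𝒟 : Set (Set ℚ_[p]) := {D | ∃ y ∈ pball x j, ∃ i, st y i ∧ (∀ i' < i, ¬ st y i') ∧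
      D = pball y (i + 1)}
    have hpar : ∀ y ∈ pball x j, ∀ i, st y i → (∀ i' < i, ¬ st y i') →
        ∀ s ∈ S, ∃ w ∈ pball y i, 1 ≤ ψ s w := by
      intro y hy i hi hmin s hs
      rcases hi.1.eq_or_lt with rfl | hlt
      · rw [pball_eq hy]; exact hsup s hs
      · by_contra! hcon
        apply hmin (i - 1) (by omega)
        refine ⟨by omega, s, hs, ?_⟩
        rwa [Nat.sub_add_cancel (by omega)]
    have hdisj : 𝒟.PairwiseDisjoint id := by
      have aux : ∀ y i y' i', st y i → st y' i' → (∀ l < i', ¬ st y' l) → i < i' →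
          ∀ w ∈ pball y (i+1), w ∉ pball y' (i'+1) := by
        intro y i y' i' h h' hm hlt w hw hw'
        apply hm i hlt
        obtain ⟨h1, s, hs, h2⟩ := h
        refine ⟨h1, s, hs, ?_⟩
        have h3 := pball_anti y' (show i + 1 ≤ i' + 1 by omega) hw'
        rwa [← pball_eq h3, pball_eq hw]
      rintro _ ⟨y, hy, i, hi, hm, rfl⟩ _ ⟨y', hy', i', hi', hm', rfl⟩ hne
      rw [Function.onFun, id, id, Set.disjoint_left]
      intro w hw hw'
      rcases lt_trichotomy i i' with h | rfl | h
      · exact aux y i y' i' hi hi' hm' h w hw hw'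
      · exact hne (by rw [← pball_eq hw, pball_eq hw'])
      · exact aux y' i' y i hi' hi hm h w hw' hw
    have hcount : 𝒟.Countable := by
      apply hdisj.countable_of_isOpen
      · rintro _ ⟨y, hy, i, hi, hm, rfl⟩; exact isOpen_pball _ _
      · rintro _ ⟨y, hy, i, hi, hm, rfl⟩; exact ⟨y, self_mem_pball _ _⟩
    have hcov : {y ∈ pball x j | ¬ IsMarked ψ ε S y} ⊆
        ⋃ D ∈ 𝒟, {y ∈ D | ¬ IsMarked ψ ε S y} := by
      rintro y ⟨hy, hnm⟩
      have hst : ∃ i, st y i := by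
        by_contra! hcon
        apply hnm
        refine ⟨∅, by simp, by simp, by simp, fun s hs _ _ => ?_⟩
        refine (hψ s).closure_subset_iff.2 subset_rfl ?_
        rw [Metric.mem_closure_iff]
        intro δ hδ
        obtain ⟨i, hi⟩ := exists_pow_lt_of_lt_one hδ (inv_lt_one_of_one_lt₀ (one_lt_prime_cast (p := p)))
        have h1 := hcon (i + j)
        simp only [st, not_and, not_exists, not_forall, not_lt] at h1
        obtain ⟨w, hw, hw1⟩ := h1 (by omega) s hs
        refine ⟨w, hw1, ?_⟩
        rw [dist_comm, dist_eq_norm]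
        have h2 := pball_anti y (show i ≤ i + j + 1 by omega) hw
        rw [mem_pball, zpow_neg, zpow_natCast, ← inv_pow] at h2
        exact h2.trans_lt hi
      simp only [Set.mem_iUnion]
      exact ⟨_, ⟨y, hy, Nat.find hst, Nat.find_spec hst, fun i' hi' => Nat.find_min hst hi', rfl⟩,
        self_mem_pball _ _, hnm⟩
    have hsubD : (⋃ D ∈ 𝒟, D) ⊆ pball x j := by
      simp only [Set.iUnion_subset_iff]
      rintro _ ⟨y, hy, i, hi, hm, rfl⟩
      rw [← pball_eq hy]
      exact pball_anti y (by have := hi.1; omega)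
    have := hcount.to_subtype
    calc _ ≤ μ (⋃ D ∈ 𝒟, {y ∈ D | ¬ IsMarked ψ ε S y}) := measure_mono hcov
      _ ≤ ∑' D : 𝒟, μ {y ∈ (D : Set ℚ_[p]) | ¬ IsMarked ψ ε S y} := measure_biUnion_le μ hcount _
      _ ≤ ∑' D : 𝒟, ((k + 1) * p ^ (k + 1) : ℕ) * η * μ (D : Set ℚ_[p]) := by
          apply ENNReal.tsum_le_tsum
          rintro ⟨_, ⟨y, hy, i, hi, hm, rfl⟩⟩
          exact key y i (hpar y hy i hi hm) hi.2
      _ = ((k + 1) * p ^ (k + 1) : ℕ) * η * μ (⋃ D ∈ 𝒟, D) := by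
          have hm : μ (⋃ D ∈ 𝒟, id D) = ∑' D : 𝒟, μ (id (D : Set ℚ_[p])) :=
            measure_biUnion hcount hdisj (by
              rintro _ ⟨y, hy, i, hi, hm, rfl⟩; exact measurableSet_pball _ _)
          simp only [id] at hm
          rw [ENNReal.tsum_mul_left, hm]
      _ ≤ _ := by gcongr

end Nondivergence

section Minors

variable {K : Type*} [NormedField K] {k N : ℕ}

/-- The largest norm of a maximal minor of a `k × N` matrix. -/
noncomputable def maxMinor (M : Matrix (Fin k) (Fin N) K) : ℝ :=
  ‖fun I : Fin k → Fin N => (M.submatrix id I).det‖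

lemma maxMinor_nonneg (M : Matrix (Fin k) (Fin N) K) : 0 ≤ maxMinor M := norm_nonneg _

lemma norm_det_le_maxMinor (M : Matrix (Fin k) (Fin N) K) (I : Fin k → Fin N) :
    ‖(M.submatrix id I).det‖ ≤ maxMinor M :=
  norm_le_pi_norm (fun I : Fin k → Fin N => (M.submatrix id I).det) I

lemma maxMinor_le {M : Matrix (Fin k) (Fin N) K} {c : ℝ} (hc : 0 ≤ c)
    (h : ∀ I : Fin k → Fin N, ‖(M.submatrix id I).det‖ ≤ c) : maxMinor M ≤ c :=
  (pi_norm_le_iff_of_nonneg hc).2 h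

lemma exists_norm_det_eq_maxMinor (M : Matrix (Fin k) (Fin N) K) (h : maxMinor M ≠ 0) :
    ∃ I : Fin k → Fin N, ‖(M.submatrix id I).det‖ = maxMinor M := by
  by_contra! hcon
  have hlt : ∀ I : Fin k → Fin N, ‖(M.submatrix id I).det‖ < maxMinor M := fun I =>
    lt_of_le_of_ne (norm_det_le_maxMinor M I) (hcon I)
  exact lt_irrefl (maxMinor M) ((pi_norm_lt_iff ((maxMinor_nonneg M).lt_of_ne' h)).2 hlt)

lemma maxMinor_mul_left (A : Matrix (Fin k) (Fin k) K) (M : Matrix (Fin k) (Fin N) K) :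
    maxMinor (A * M) = ‖A.det‖ * maxMinor M := by
  rw [maxMinor, maxMinor, ← norm_smul]
  congr 1
  ext I
  rw [Pi.smul_apply, smul_eq_mul, ← Matrix.det_mul]
  rfl

lemma maxMinor_mul_right_le {B : Matrix (Fin N) (Fin N) K} {c : ℝ} (hB : ∀ i j, ‖B i j‖ ≤ c)
    (M : Matrix (Fin k) (Fin N) K) (hc : 0 ≤ c) :
    maxMinor (M * B) ≤ N ^ k * c ^ k * maxMinor M := by
  have := maxMinor_nonneg M
  refine maxMinor_le (by positivity) fun I => ?_
  have h : ((M * B).submatrix id I).det =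
      ∑ J : Fin k → Fin N, (∏ m, B (J m) (I m)) * (M.submatrix id J).det := by
    rw [← Matrix.det_transpose]
    have h1 : ((M * B).submatrix id I).transpose =
        fun m => ∑ i, B i (I m) • (fun l => M l i) := by
      ext m l
      simp [Matrix.mul_apply, mul_comm]
    rw [h1]
    change Matrix.detRowAlternating _ = _
    rw [← AlternatingMap.coe_multilinearMap, MultilinearMap.map_sum]
    refine Finset.sum_congr rfl fun J _ => ?_
    rw [MultilinearMap.map_smul_univ, smul_eq_mul, ← Matrix.det_transpose (M.submatrix id J)]
    rfl
  rw [h]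
  calc _ ≤ ∑ J : Fin k → Fin N, ‖(∏ m, B (J m) (I m)) * (M.submatrix id J).det‖ := norm_sum_le _ _
    _ ≤ ∑ _J : Fin k → Fin N, c ^ k * maxMinor M := by
        refine Finset.sum_le_sum fun J _ => ?_
        rw [norm_mul, norm_prod]
        gcongr
        · calc _ ≤ ∏ _m : Fin k, c := Finset.prod_le_prod (fun _ _ => norm_nonneg _) fun m _ => hB _ _
            _ = _ := by simp
        · exact norm_det_le_maxMinor M J
    _ = _ := by simp; ring

lemma maxMinor_succ_le (M : Matrix (Fin (k + 1)) (Fin N) K) {c : ℝ} (hc : ∀ j, ‖M 0 j‖ ≤ c)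
    (hc0 : 0 ≤ c) : maxMinor M ≤ (k + 1) * c * maxMinor (M.submatrix Fin.succ id) := by
  have := maxMinor_nonneg (M.submatrix Fin.succ id)
  refine maxMinor_le (by positivity) fun I => ?_
  rw [Matrix.det_succ_row_zero]
  calc _ ≤ ∑ _j : Fin (k + 1), c * maxMinor (M.submatrix Fin.succ id) := by
        refine (norm_sum_le _ _).trans (Finset.sum_le_sum fun j _ => ?_)
        rw [norm_mul, norm_mul, norm_pow, norm_neg, norm_one, one_pow, one_mul]
        gcongr
        · exact hc _
        · exact norm_det_le_maxMinor (M.submatrix Fin.succ id) (I ∘ j.succAbove)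
    _ = _ := by simp; ring

lemma continuous_maxMinor {X : Type*} [TopologicalSpace X] {f : X → Matrix (Fin k) (Fin N) K}
    (hf : Continuous f) : Continuous fun x => maxMinor (f x) := by
  refine Continuous.norm (continuous_pi fun I => ?_)
  exact (hf.matrix_submatrix id I).matrix_det

end Minors

section Value

/-- The matrix of Taylor coefficients: row vectors of coefficients are sent to the coefficients
of the expansion at `x`. -/
def taylorMatrix (N : ℕ) {R : Type*} [CommRing R] (x : R) : Matrix (Fin N) (Fin N) R :=
  Matrix.of fun i j => (Nat.choose i j : R) * x ^ ((i : ℕ) - j)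

lemma taylorMatrix_map {N : ℕ} {R S : Type*} [CommRing R] [CommRing S] (f : R →+* S) (x : R) :
    (taylorMatrix N x).map f = taylorMatrix N (f x) := by
  ext i j; simp [taylorMatrix]

lemma det_taylorMatrix {N : ℕ} {R : Type*} [CommRing R] (x : R) : (taylorMatrix N x).det = 1 := by
  rw [Matrix.det_of_isLowerTriangular]
  · simp [taylorMatrix]
  · intro i j hij
    simp only [taylorMatrix, Matrix.of_apply]
    rw [Nat.choose_eq_zero_of_lt (by simpa using hij)]; simp

variable (p : ℕ) [Fact p.Prime] (a b : ℕ) (T : ℝ) {k N : ℕ}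

/-- The weights `p ^ (-a), p ^ (-b), 1, …, 1`. -/
noncomputable def weight (N : ℕ) (j : Fin N) : ℚ_[p] :=
  if (j : ℕ) = 0 then ((p : ℚ_[p]) ^ a)⁻¹ else if (j : ℕ) = 1 then ((p : ℚ_[p]) ^ b)⁻¹ else 1

lemma one_le_norm_weight (j : Fin N) : 1 ≤ ‖weight p a b N j‖ := by
  have h : ∀ c : ℕ, 1 ≤ ‖((p : ℚ_[p]) ^ c)⁻¹‖ := fun c => by
    rw [norm_inv, norm_pow, Padic.norm_p, inv_pow, inv_inv]
    exact one_le_pow₀ one_lt_prime_cast.le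
  unfold weight
  split_ifs
  · exact h a
  · exact h b
  · simp

/-- The weighted Taylor coefficients at `x` of the polynomials with coefficients in the rows. -/
noncomputable def weightedTaylor (u : Matrix (Fin k) (Fin N) ℤ) (x : ℚ_[p]) :
    Matrix (Fin k) (Fin N) ℚ_[p] :=
  u.map (Int.cast : ℤ → ℚ_[p]) * taylorMatrix N x * Matrix.diagonal (weight p a b N)

/-- The normalized covolume of the lattice spanned by the rows of `u`. -/
noncomputable def covol (u : Matrix (Fin k) (Fin N) ℤ) (x : ℚ_[p]) : ℝ :=
  (T ^ k)⁻¹ * maxMinor (u.map (Int.cast : ℤ → ℝ)) * maxMinor (weightedTaylor p a b u x)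

variable {p}

lemma one_le_abs_mul_norm {z : ℤ} (hz : z ≠ 0) : 1 ≤ |(z : ℝ)| * ‖(z : ℚ_[p])‖ := by
  have hz' : (z : ℚ_[p]) ≠ 0 := by exact_mod_cast hz
  have h1 := Padic.norm_eq_zpow_neg_valuation hz'
  have h2 : 0 ≤ (z : ℚ_[p]).valuation := by
    rw [← Padic.norm_le_one_iff_val_nonneg]; exact Padic.norm_int_le_one z
  obtain ⟨m, hm⟩ := Int.eq_ofNat_of_zero_le h2
  rw [hm] at h1
  have h3 : ((p ^ m : ℕ) : ℤ) ∣ z := by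
    have := (Padic.norm_int_le_pow_iff_dvd (p := p) z m).1 h1.le
    exact_mod_cast this
  have h4 : ((p ^ m : ℕ) : ℝ) ≤ |(z : ℝ)| := by
    have := Int.le_of_dvd (abs_pos.2 hz) ((dvd_abs _ _).2 h3)
    exact_mod_cast this
  rw [h1, zpow_neg, zpow_natCast]
  push_cast at h4
  rw [← div_eq_mul_inv, one_le_div (pow_pos prime_cast_pos _)]
  exact h4

lemma weightedTaylor_mul_left (A : Matrix (Fin k) (Fin k) ℤ) (u : Matrix (Fin k) (Fin N) ℤ)
    (x : ℚ_[p]) : weightedTaylor p a b (A * u) x =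
      A.map (Int.cast : ℤ → ℚ_[p]) * weightedTaylor p a b u x := by
  have := Matrix.map_mul (L := A) (M := u) (f := Int.castRingHom ℚ_[p])
  simp only [Int.coe_castRingHom] at this
  simp only [weightedTaylor, this, Matrix.mul_assoc]

variable {T}

lemma covol_nonneg (hT : 0 < T) (u : Matrix (Fin k) (Fin N) ℤ) (x : ℚ_[p]) :
    0 ≤ covol p a b T u x := by
  have := maxMinor_nonneg (u.map (Int.cast : ℤ → ℝ))
  have := maxMinor_nonneg (weightedTaylor p a b u x)
  unfold covol; positivity

lemma covol_le_mul_left (hT : 0 < T) {A : Matrix (Fin k) (Fin k) ℤ} (hA : A.det ≠ 0)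
    (u : Matrix (Fin k) (Fin N) ℤ) (x : ℚ_[p]) :
    covol p a b T u x ≤ covol p a b T (A * u) x := by
  have h1 : maxMinor ((A * u).map (Int.cast : ℤ → ℝ)) =
      |(A.det : ℝ)| * maxMinor (u.map (Int.cast : ℤ → ℝ)) := by
    have := Matrix.map_mul (L := A) (M := u) (f := Int.castRingHom ℝ)
    simp only [Int.coe_castRingHom] at this
    rw [this, maxMinor_mul_left, ← Real.norm_eq_abs]
    congr 2
    exact ((Int.castRingHom ℝ).map_det A).symm
  have h2 : maxMinor (weightedTaylor p a b (A * u) x) =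
      ‖(A.det : ℚ_[p])‖ * maxMinor (weightedTaylor p a b u x) := by
    rw [weightedTaylor_mul_left, maxMinor_mul_left]
    congr 2
    exact ((Int.castRingHom ℚ_[p]).map_det A).symm
  have h3 : covol p a b T (A * u) x =
      (|(A.det : ℝ)| * ‖(A.det : ℚ_[p])‖) * covol p a b T u x := by
    rw [covol, h1, h2, covol]; ring
  rw [h3]
  exact le_mul_of_one_le_left (covol_nonneg a b hT u x) (one_le_abs_mul_norm hA)

lemma covol_succ_le (hT : 0 < T) (u : Matrix (Fin (k + 1)) (Fin N) ℤ) (x : ℚ_[p]) {h : ℝ}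
    (h0 : 0 ≤ h) (hu : ∀ j, |(u 0 j : ℝ)| ≤ h) (hp : ∀ j, ‖weightedTaylor p a b u x 0 j‖ ≤ 1) :
    covol p a b T u x ≤ (k + 1) ^ 2 * (h / T) * covol p a b T (u.submatrix Fin.succ id) x := by
  have h1 := maxMinor_succ_le (u.map (Int.cast : ℤ → ℝ)) (c := h) (fun j => by simpa using hu j) h0
  have h2 := maxMinor_succ_le (weightedTaylor p a b u x) (c := 1) hp zero_le_one
  have h3 : (weightedTaylor p a b u x).submatrix Fin.succ id =
      weightedTaylor p a b (u.submatrix Fin.succ id) x := by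
    ext i j; simp [weightedTaylor, Matrix.mul_apply]
  have h4 : (u.map (Int.cast : ℤ → ℝ)).submatrix Fin.succ id =
      (u.submatrix Fin.succ id).map (Int.cast : ℤ → ℝ) := rfl
  rw [h3] at h2
  rw [h4] at h1
  have e1 := maxMinor_nonneg ((u.submatrix Fin.succ id).map (Int.cast : ℤ → ℝ))
  have e2 := maxMinor_nonneg (weightedTaylor p a b u x)
  calc covol p a b T u x ≤ (T ^ (k + 1))⁻¹ *
        ((k + 1) * h * maxMinor ((u.submatrix Fin.succ id).map (Int.cast : ℤ → ℝ))) *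
        ((k + 1) * 1 * maxMinor (weightedTaylor p a b (u.submatrix Fin.succ id) x)) := by
        unfold covol; gcongr
    _ = _ := by rw [covol, pow_succ]; field_simp

lemma continuous_covol (u : Matrix (Fin k) (Fin N) ℤ) : Continuous (covol p a b T u) := by
  refine continuous_const.mul (continuous_maxMinor ?_)
  refine Continuous.matrix_mul (Continuous.matrix_mul continuous_const ?_) continuous_const
  refine continuous_pi fun i => continuous_pi fun j => ?_
  exact continuous_const.mul (continuous_id.pow _)

lemma det_weightedTaylor_submatrix (u : Matrix (Fin k) (Fin N) ℤ) (x : ℚ_[p]) (I : Fin k → Fin N) :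
    ((weightedTaylor p a b u x).submatrix id I).det = (∏ m, weight p a b N (I m)) *
      ((u.map (Int.cast : ℤ → ℚ_[p]) * taylorMatrix N x).submatrix id I).det := by
  rw [← Matrix.det_mul_row]
  congr 1
  ext l m
  simp [weightedTaylor, Matrix.mul_diagonal, mul_comm]

lemma exists_polynomial_covol (hT : 0 < T) (u : Matrix (Fin k) (Fin N) ℤ) {y₀ : ℚ_[p]}
    (hy : 1 ≤ covol p a b T u y₀) : ∃ (f : ℚ_[p][X]) (c : ℝ), f.natDegree ≤ k * N ∧ 0 < c ∧
      covol p a b T u y₀ = c * ‖f.eval y₀‖ ∧ ∀ y, c * ‖f.eval y‖ ≤ covol p a b T u y := by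
  have h0 : maxMinor (weightedTaylor p a b u y₀) ≠ 0 := by
    intro h; rw [covol, h] at hy; simp at hy; linarith
  obtain ⟨I, hI⟩ := exists_norm_det_eq_maxMinor _ h0
  set A := maxMinor (u.map (Int.cast : ℤ → ℝ)) with hA
  have hA0 : 0 ≤ A := maxMinor_nonneg _
  have hA1 : A ≠ 0 := by
    intro h; rw [covol, ← hA, h] at hy; simp at hy; linarith
  have hA2 : 0 < A := hA0.lt_of_ne' hA1
  let F : Matrix (Fin k) (Fin N) ℚ_[p][X] :=
    u.map (fun z => C (z : ℚ_[p])) * taylorMatrix N (X : ℚ_[p][X])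
  let f : ℚ_[p][X] := (F.submatrix id I).det
  have hf : ∀ y, f.eval y = ((u.map (Int.cast : ℤ → ℚ_[p]) * taylorMatrix N y).submatrix id I).det := by
    intro y
    change evalRingHom y _ = _
    rw [RingHom.map_det]
    congr 1
    ext l m
    simp [F, Matrix.mul_apply, taylorMatrix, eval_finsetSum]
  have hv : ∀ y, ((T ^ k)⁻¹ * A * ‖∏ m, weight p a b N (I m)‖) * ‖f.eval y‖ =
      (T ^ k)⁻¹ * A * ‖((weightedTaylor p a b u y).submatrix id I).det‖ := by
    intro y
    rw [det_weightedTaylor_submatrix, hf, norm_mul]; ring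
  refine ⟨f, (T ^ k)⁻¹ * A * ‖∏ m, weight p a b N (I m)‖, ?_, ?_, ?_, ?_⟩
  · change (F.submatrix id I).det.natDegree ≤ _
    rw [Matrix.det_apply]
    refine natDegree_sum_le_of_forall_le _ _ fun σ _ => ?_
    refine (natDegree_smul_le _ _).trans ?_
    refine (natDegree_prod_le _ _).trans ?_
    calc _ ≤ ∑ _m : Fin k, N := by
          refine Finset.sum_le_sum fun m _ => ?_
          simp only [F, Matrix.submatrix_apply, Matrix.mul_apply]
          refine natDegree_sum_le_of_forall_le _ _ fun i _ => ?_
          simp only [Matrix.map_apply, taylorMatrix, Matrix.of_apply]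
          refine (natDegree_C_mul_le _ _).trans ?_
          rw [← C_eq_natCast]
          refine (natDegree_C_mul_le _ _).trans ?_
          rw [natDegree_X_pow]
          have := i.2; omega
      _ = _ := by simp
  · have : 0 < ‖∏ m, weight p a b N (I m)‖ := by
      rw [norm_prod]
      exact Finset.prod_pos fun m _ => zero_lt_one.trans_le (one_le_norm_weight p a b _)
    positivity
  · rw [hv, hI]; rfl
  · intro y
    rw [hv]
    unfold covol
    gcongr
    exact norm_det_le_maxMinor _ I

lemma measure_covol_lt_le (μ : Measure ℚ_[p]) [μ.IsAddHaarMeasure] (hT : 0 < T) {d : ℕ}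
    (hd : k * N ≤ d) (u : Matrix (Fin k) (Fin N) ℤ) (i : ℕ) (x : ℚ_[p]) (j : ℕ)
    (h : ∃ y ∈ pball x j, 1 ≤ covol p a b T u y) :
    μ {y ∈ pball x j | covol p a b T u y < ((p : ℝ) ^ (i * d))⁻¹} ≤
      (d * ((p : ENNReal) ^ i)⁻¹) * μ (pball x j) := by
  obtain ⟨y₀, hy₀, h1⟩ := h
  obtain ⟨f, c, hf, hc, hfc, hle⟩ := exists_polynomial_covol a b hT u h1
  have h2 := measure_small_le μ i (hf.trans hd) hy₀
  have hp : (p : ENNReal) ^ i ≠ 0 := pow_ne_zero _ (by exact_mod_cast (Fact.out : p.Prime).ne_zero)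
  have hp' : (p : ENNReal) ^ i ≠ ⊤ := ENNReal.pow_ne_top (by simp)
  calc _ ≤ μ {y ∈ pball x j | ‖f.eval y‖ * (p : ℝ) ^ (i * d) < ‖f.eval y₀‖} := by
        refine measure_mono fun y hy => ⟨hy.1, ?_⟩
        have h3 := (hle y).trans_lt hy.2
        have hpos : (0 : ℝ) < (p : ℝ) ^ (i * d) := pow_pos prime_cast_pos _
        rw [← one_div, lt_div_iff₀ hpos] at h3
        refine lt_of_mul_lt_mul_left (a := c) ?_ hc.le
        rw [← mul_assoc, ← hfc]
        exact h3.trans_le h1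
    _ ≤ _ := h2
    _ = _ := by
      rw [measure_pball_add μ x j i, mul_assoc, ← mul_assoc (((p : ENNReal) ^ i)⁻¹),
        ENNReal.inv_mul_cancel hp hp', one_mul]

end Value

section LinearAlgebra

lemma Matrix.exists_det_submatrix_ne_zero {K : Type*} [Field K] {k N : ℕ}
    {G : Matrix (Fin k) (Fin N) K} (hG : LinearIndependent K G.row) (s : Set (Fin N))
    (hs : LinearIndepOn K G.col s) :
    ∃ I : Fin k → Fin N, Function.Injective I ∧ s ⊆ Set.range I ∧ (G.submatrix id I).det ≠ 0 := by
  classical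
  set B := hs.extend (Set.subset_univ s) with hB
  have hli : LinearIndepOn K G.col B := hs.linearIndepOn_extend _
  have hspan : Submodule.span K (G.col '' B) = Submodule.span K (Set.range G.col) := by
    rw [hB, hs.span_image_extend_eq_span_image, Set.image_univ]
  have hcard : Fintype.card B = k := by
    have h1 := finrank_span_eq_card (R := K) hli
    have h2 : Set.range (fun x : B => G.col x) = G.col '' B := by
      ext; simp
    rw [h2, hspan, ← Matrix.rank_eq_finrank_span_cols, hG.rank_matrix, Fintype.card_fin] at h1
    exact h1.symm
  let e : Fin k ≃ B := (finCongr hcard.symm).trans (Fintype.equivFin B).symm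
  refine ⟨fun m => e m, Subtype.val_injective.comp e.injective, ?_, ?_⟩
  · intro j hj
    exact ⟨e.symm ⟨j, hs.subset_extend _ hj⟩, by simp⟩
  · rw [← isUnit_iff_ne_zero, ← Matrix.isUnit_iff_isUnit_det,
      ← Matrix.linearIndependent_cols_iff_isUnit]
    exact hli.comp e e.injective

lemma Polynomial.wronskian_ne_zero_of_linearIndependent {K : Type*} [Field K] [CharZero K]
    {P Q : K[X]} (h : LinearIndependent K ![P, Q]) : wronskian P Q ≠ 0 := by
  intro hw
  rw [LinearIndependent.pair_iff] at h
  have hP : P ≠ 0 := by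
    rintro rfl
    have := h 1 0 (by simp)
    simp at this
  classical
  have hg : gcd P Q ≠ 0 := by
    rw [Ne, gcd_eq_zero_iff]; exact fun h => hP h.1
  obtain ⟨A, hA⟩ := gcd_dvd_left P Q
  obtain ⟨B, hB⟩ := gcd_dvd_right P Q
  set g := gcd P Q
  have hcop : IsCoprime A B := by
    rw [← gcd_isUnit_iff]
    have : gcd P Q * gcd A B ∣ gcd P Q := by
      refine dvd_gcd ?_ ?_
      · exact (mul_dvd_mul_left _ (gcd_dvd_left A B)).trans (dvd_of_eq hA.symm)
      · exact (mul_dvd_mul_left _ (gcd_dvd_right A B)).trans (dvd_of_eq hB.symm)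
    have h2 : gcd P Q * gcd A B ∣ gcd P Q * 1 := by simpa using this
    exact isUnit_of_dvd_one ((mul_dvd_mul_iff_left hg).1 h2)
  have hw2 : wronskian A B = 0 := by
    have : wronskian P Q = g ^ 2 * wronskian A B := by
      rw [hA, hB]; simp only [wronskian, derivative_mul]; ring
    rw [hw] at this
    exact (mul_eq_zero.1 this.symm).resolve_left (pow_ne_zero 2 hg)
  obtain ⟨h1, h2⟩ := hcop.wronskian_eq_zero_iff.1 hw2
  have e1 := derivative_eq_zero.1 h1
  have e2 := derivative_eq_zero.1 h2
  rw [natDegree_eq_zero] at e1 e2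
  obtain ⟨α, rfl⟩ := e1
  obtain ⟨β, rfl⟩ := e2
  have := h β (-α) (by
    rw [hA, hB, smul_eq_C_mul, smul_eq_C_mul, C_neg]; ring)
  apply hP
  rw [hA, neg_eq_zero.1 this.2]
  simp

end LinearAlgebra

section Taylor

variable {R : Type*} [CommRing R] {N k : ℕ}

/-- The integer polynomial with coefficient vector `v`. -/
noncomputable def vecPoly (v : Fin N → ℤ) : ℤ[X] := ∑ i : Fin N, monomial (i : ℕ) (v i)

lemma coeff_vecPoly (v : Fin N → ℤ) (i : Fin N) : (vecPoly v).coeff i = v i := by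
  simp [vecPoly, coeff_monomial, ← Fin.ext_iff]

lemma coeff_vecPoly_of_le (v : Fin N → ℤ) {i : ℕ} (h : N ≤ i) : (vecPoly v).coeff i = 0 := by
  simp only [vecPoly, finsetSum_coeff, coeff_monomial]
  exact Finset.sum_eq_zero fun j _ => if_neg (by have := j.2; omega)

lemma vecPoly_add (v w : Fin N → ℤ) : vecPoly (v + w) = vecPoly v + vecPoly w := by
  simp [vecPoly, Finset.sum_add_distrib]

lemma vecPoly_smul (c : ℤ) (v : Fin N → ℤ) : vecPoly (c • v) = c • vecPoly v := by
  simp [vecPoly, Finset.smul_sum, smul_monomial]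

lemma vecMul_taylorMatrix (v : Fin N → ℤ) (x : R) (j : Fin N) :
    Matrix.vecMul (fun i => (v i : R)) (taylorMatrix N x) j =
      (hasseDeriv j ((vecPoly v).map (Int.castRingHom R))).eval x := by
  simp only [vecPoly, Polynomial.map_sum, map_sum, map_monomial, hasseDeriv_monomial,
    eval_finsetSum, eval_monomial, Matrix.vecMul, dotProduct, taylorMatrix, Matrix.of_apply]
  refine Finset.sum_congr rfl fun i _ => ?_
  simp; ring

lemma mul_taylorMatrix_apply (u : Matrix (Fin k) (Fin N) ℤ) (x : R) (i : Fin k) (j : Fin N) :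
    (u.map (Int.cast : ℤ → R) * taylorMatrix N x) i j =
      (hasseDeriv j ((vecPoly (u i)).map (Int.castRingHom R))).eval x := by
  rw [← vecMul_taylorMatrix, Matrix.mul_apply]
  rfl

end Taylor

section Nondegenerate

variable {p : ℕ} [Fact p.Prime] (a b : ℕ) {T : ℝ} {k N : ℕ}

lemma prod_norm_weight_le {I : Fin k → Fin N} (hI : Function.Injective I) {t : Finset (Fin N)}
    (ht : (t : Set (Fin N)) ⊆ Set.range I) :
    ∏ j ∈ t, ‖weight p a b N j‖ ≤ ‖∏ m, weight p a b N (I m)‖ := by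
  classical
  have h1 : ‖∏ m, weight p a b N (I m)‖ = ∏ j ∈ Finset.univ.image I, ‖weight p a b N j‖ := by
    rw [Finset.prod_image (fun _ _ _ _ h => hI h), norm_prod]
  have h2 : t ⊆ Finset.univ.image I := fun j hj => by
    obtain ⟨m, hm⟩ := ht hj
    exact Finset.mem_image.2 ⟨m, Finset.mem_univ _, hm⟩
  rw [h1, ← Finset.prod_sdiff h2]
  refine le_mul_of_one_le_left (Finset.prod_nonneg fun _ _ => norm_nonneg _) ?_
  exact Finset.prod_induction _ (1 ≤ ·) (fun _ _ => one_le_mul_of_one_le_of_one_le) le_rfl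
    fun j _ => one_le_norm_weight p a b j

lemma norm_prod_weight_le (hT : 0 < T) (u : Matrix (Fin k) (Fin N) ℤ) (z : ℤ) (I : Fin k → Fin N)
    {B : ℝ} (hB0 : 0 ≤ B) (hB : |((((u * taylorMatrix N z).submatrix id I).det : ℤ) : ℝ)| ≤
      B * maxMinor (u.map (Int.cast : ℤ → ℝ)))
    (hD : ((u * taylorMatrix N z).submatrix id I).det ≠ 0) :
    ‖∏ m, weight p a b N (I m)‖ ≤ T ^ k * B * covol p a b T u (z : ℚ_[p]) := by
  set D := ((u * taylorMatrix N z).submatrix id I).det with hDdef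
  have hDp : ((u.map (Int.cast : ℤ → ℚ_[p]) * taylorMatrix N (z : ℚ_[p])).submatrix id I).det =
      (D : ℚ_[p]) := by
    have h1 := Matrix.map_mul (L := u) (M := taylorMatrix N z) (f := Int.castRingHom ℚ_[p])
    rw [taylorMatrix_map] at h1
    have h2 := (Int.castRingHom ℚ_[p]).map_det ((u * taylorMatrix N z).submatrix id I)
    rw [← hDdef] at h2
    simp only [Int.coe_castRingHom, eq_intCast] at h1 h2
    rw [h2, ← h1]
    rfl
  have h1 := norm_det_le_maxMinor (weightedTaylor p a b u (z : ℚ_[p])) I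
  rw [det_weightedTaylor_submatrix, hDp, norm_mul] at h1
  set w := ‖∏ m, weight p a b N (I m)‖
  have hw : 0 ≤ w := norm_nonneg _
  have hM := maxMinor_nonneg (u.map (Int.cast : ℤ → ℝ))
  calc w ≤ w * (|(D : ℝ)| * ‖(D : ℚ_[p])‖) := le_mul_of_one_le_right hw (one_le_abs_mul_norm hD)
    _ ≤ w * ((B * maxMinor (u.map (Int.cast : ℤ → ℝ))) * ‖(D : ℚ_[p])‖) := by gcongr
    _ = B * maxMinor (u.map (Int.cast : ℤ → ℝ)) * (w * ‖(D : ℚ_[p])‖) := by ring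
    _ ≤ B * maxMinor (u.map (Int.cast : ℤ → ℝ)) *
        maxMinor (weightedTaylor p a b u (z : ℚ_[p])) := by gcongr
    _ = _ := by rw [covol]; field_simp

lemma abs_det_le (u : Matrix (Fin k) (Fin N) ℤ) (z : ℤ) (I : Fin k → Fin N) {c : ℝ} (hc : 0 ≤ c)
    (hz : ∀ i j, |taylorMatrix N (z : ℝ) i j| ≤ c) :
    |((((u * taylorMatrix N z).submatrix id I).det : ℤ) : ℝ)| ≤
      N ^ k * c ^ k * maxMinor (u.map (Int.cast : ℤ → ℝ)) := by
  refine le_trans ?_ (maxMinor_mul_right_le (B := taylorMatrix N (z : ℝ)) hz _ hc)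
  refine le_trans (le_of_eq ?_) (norm_det_le_maxMinor _ I)
  have h1 := Matrix.map_mul (L := u) (M := taylorMatrix N z) (f := Int.castRingHom ℝ)
  rw [taylorMatrix_map] at h1
  have h2 := (Int.castRingHom ℝ).map_det ((u * taylorMatrix N z).submatrix id I)
  simp only [Int.coe_castRingHom, eq_intCast] at h1 h2
  rw [h2, ← h1, Real.norm_eq_abs]
  rfl

lemma norm_weight_zero [NeZero N] : ‖weight p a b N 0‖ = (p : ℝ) ^ a := by
  simp [weight]

lemma norm_weight_one {j : Fin N} (hj : (j : ℕ) = 1) : ‖weight p a b N j‖ = (p : ℝ) ^ b := by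
  simp [weight, hj]

lemma exists_intCast_eval_ne_zero {P : ℚ[X]} (hP : P ≠ 0) {m : ℕ} (hm : P.natDegree < m)
    {f : ℕ → ℤ} (hf : Function.Injective f) : ∃ t < m, P.eval (f t : ℚ) ≠ 0 := by
  by_contra! h
  apply hP
  refine eq_zero_of_natDegree_lt_card_of_eval_eq_zero P (ι := Fin m)
    (f := fun t => (f t : ℚ)) ?_ (fun t => h t t.2) (by simpa using hm)
  intro s t hst
  exact Fin.ext (hf (by simpa using hst))

lemma exists_intCast_mem_pball {x : ℚ_[p]} (hx : ‖x‖ ≤ 1) (j : ℕ) :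
    ∃ z : ℤ, (z : ℚ_[p]) ∈ pball x j := by
  have h := PadicInt.appr_spec j (⟨x, hx⟩ : ℤ_[p])
  rw [← PadicInt.norm_le_pow_iff_mem_span_pow] at h
  refine ⟨PadicInt.appr (⟨x, hx⟩ : ℤ_[p]) j, ?_⟩
  rw [mem_pball, norm_sub_rev]
  exact_mod_cast h

lemma add_mul_pow_mem_pball {x : ℚ_[p]} {j : ℕ} {z : ℤ} (hz : (z : ℚ_[p]) ∈ pball x j) (t : ℕ) :
    ((z + t * p ^ j : ℤ) : ℚ_[p]) ∈ pball x j := by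
  rw [← pball_eq hz, mem_pball]
  push_cast
  rw [add_sub_cancel_left, norm_mul, norm_pow, Padic.norm_p, zpow_neg, zpow_natCast, inv_pow]
  exact mul_le_of_le_one_left (by positivity) (by simpa using Padic.norm_int_le_one (p := p) t)

/-- The coefficient vector over `ℚ`. -/
def ratVec (v : Fin N → ℤ) : Fin N → ℚ := fun i => v i

lemma linearIndependent_row_mul_taylor {u : Matrix (Fin k) (Fin N) ℤ}
    (hu : LinearIndependent ℚ fun i => ratVec (u i)) (z : ℤ) :
    LinearIndependent ℚ (u.map (Int.cast : ℤ → ℚ) * taylorMatrix N (z : ℚ)).row := by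
  have h := hu.map' (Matrix.vecMulLinear (taylorMatrix N (z : ℚ))) (by
    rw [LinearMap.ker_eq_bot]
    refine Matrix.vecMul_injective_of_isUnit ?_
    rw [Matrix.isUnit_iff_isUnit_det, det_taylorMatrix]; exact isUnit_one)
  exact h

lemma det_intCast_ne_zero {u : Matrix (Fin k) (Fin N) ℤ} {z : ℤ} {I : Fin k → Fin N}
    (h : ((u.map (Int.cast : ℤ → ℚ) * taylorMatrix N (z : ℚ)).submatrix id I).det ≠ 0) :
    ((u * taylorMatrix N z).submatrix id I).det ≠ 0 := by
  have h1 := Matrix.map_mul (L := u) (M := taylorMatrix N z) (f := Int.castRingHom ℚ)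
  rw [taylorMatrix_map] at h1
  have h2 := (Int.castRingHom ℚ).map_det ((u * taylorMatrix N z).submatrix id I)
  simp only [Int.coe_castRingHom, eq_intCast] at h1 h2
  intro h0
  rw [h0, Int.cast_zero] at h2
  apply h
  rw [← h1]
  exact h2.symm

lemma linearIndependent_vecPoly {u : Matrix (Fin k) (Fin N) ℤ}
    (hu : LinearIndependent ℚ fun i => ratVec (u i)) :
    LinearIndependent ℚ fun i => (vecPoly (u i)).map (Int.castRingHom ℚ) := by
  rw [Fintype.linearIndependent_iff] at hu ⊢
  intro g hg
  refine hu g (funext fun j => ?_)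
  have := congrArg (fun P : ℚ[X] => P.coeff j) hg
  simpa [coeff_vecPoly, ratVec] using this

lemma natDegree_vecPoly_map_lt (hN : 0 < N) (v : Fin N → ℤ) :
    ((vecPoly v).map (Int.castRingHom ℚ)).natDegree < N := by
  refine lt_of_le_of_lt (b := N - 1) (natDegree_le_iff_coeff_eq_zero.2 fun i hi => ?_) (by omega)
  rw [coeff_map, coeff_vecPoly_of_le v (by omega), map_zero]

lemma sq_le_prime_pow (hN : 3 ≤ N) (hT1 : 1 ≤ T) (hT : T ^ N = (p : ℝ) ^ (a + b))
    (hab : 2 * b ≤ a) : T ^ 2 ≤ (p : ℝ) ^ a := by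
  have hp := (one_lt_prime_cast (p := p)).le
  refine le_of_pow_le_pow_left₀ (n := 3) (by norm_num) (by positivity) ?_
  calc (T ^ 2) ^ 3 = T ^ (3 * 2) := by ring
    _ ≤ T ^ (N * 2) := pow_le_pow_right₀ hT1 (by omega)
    _ = (p : ℝ) ^ ((a + b) * 2) := by rw [pow_mul, hT, pow_mul]
    _ ≤ (p : ℝ) ^ (a * 3) := pow_le_pow_right₀ hp (by omega)
    _ = _ := pow_mul _ _ _

lemma one_le_covol_of_le (hT1 : 1 ≤ T) (u : Matrix (Fin k) (Fin N) ℤ) (hk : k ≤ N) (z : ℤ)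
    {c : ℝ} (hc : 1 ≤ N * c) (hcT : (N * c) ^ N ≤ T) (hc0 : 0 ≤ c)
    (hz : ∀ i j, |taylorMatrix N (z : ℝ) i j| ≤ c) (I : Fin k → Fin N)
    (hD : ((u * taylorMatrix N z).submatrix id I).det ≠ 0)
    (hW : T ^ (k + 1) ≤ ‖∏ m, weight p a b N (I m)‖) : 1 ≤ covol p a b T u (z : ℚ_[p]) := by
  have hT0 : 0 < T := by linarith
  have h1 := norm_prod_weight_le (p := p) a b hT0 u z I (by positivity) (abs_det_le u z I hc0 hz) hD
  have h2 := covol_nonneg a b hT0 u (z : ℚ_[p])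
  set V := covol p a b T u (z : ℚ_[p])
  have h3 : (N : ℝ) ^ k * c ^ k ≤ T := by
    rw [← mul_pow]; exact (pow_le_pow_right₀ hc hk).trans hcT
  have h4 : T ^ k * T ≤ T ^ k * T * V := by
    calc T ^ k * T = T ^ (k + 1) := (pow_succ _ _).symm
      _ ≤ _ := hW.trans h1
      _ ≤ _ := by gcongr
  exact le_of_mul_le_mul_left (by simpa using h4) (show 0 < T ^ k * T by positivity)

lemma exists_one_le_covol (hN : 3 ≤ N) {x : ℚ_[p]} (hx : ‖x‖ ≤ 1) (j : ℕ) :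
    ∃ T₀ : ℝ, ∀ (a b : ℕ) (T : ℝ), T₀ ≤ T → T ^ N = (p : ℝ) ^ (a + b) → 2 * b ≤ a →
      ∀ (k : ℕ) (u : Matrix (Fin k) (Fin N) ℤ), (LinearIndependent ℚ fun i => ratVec (u i)) →
        ∃ y ∈ pball x j, 1 ≤ covol p a b T u y := by
  obtain ⟨z, hz⟩ := exists_intCast_mem_pball hx j
  let f : ℕ → ℤ := fun t => z + t * p ^ j
  have hf : Function.Injective f := by
    intro s t hst
    have hp : (p : ℤ) ^ j ≠ 0 := pow_ne_zero _ (by exact_mod_cast (Fact.out : p.Prime).ne_zero)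
    have : (s : ℤ) * p ^ j = t * p ^ j := add_left_cancel hst
    exact_mod_cast mul_right_cancel₀ hp this
  have hfb : ∀ t, (f t : ℚ_[p]) ∈ pball x j := fun t => add_mul_pow_mem_pball hz t
  let S : ℝ := ∑ t ∈ Finset.range (2 * N), ∑ i, ∑ l, |taylorMatrix N (f t : ℝ) i l|
  have hS : 0 ≤ S := by positivity
  have hfS : ∀ t < 2 * N, ∀ i l, |taylorMatrix N (f t : ℝ) i l| ≤ 1 + S := by
    intro t ht i l
    have h1 : |taylorMatrix N (f t : ℝ) i l| ≤ ∑ l, |taylorMatrix N (f t : ℝ) i l| :=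
      Finset.single_le_sum (f := fun l => |taylorMatrix N (f t : ℝ) i l|)
        (fun _ _ => abs_nonneg _) (Finset.mem_univ l)
    have h2 : _ ≤ ∑ i, ∑ l, |taylorMatrix N (f t : ℝ) i l| :=
      Finset.single_le_sum (f := fun i => ∑ l, |taylorMatrix N (f t : ℝ) i l|)
        (fun _ _ => by positivity) (Finset.mem_univ i)
    have h3 : _ ≤ S := Finset.single_le_sum
      (f := fun t => ∑ i, ∑ l, |taylorMatrix N (f t : ℝ) i l|)
        (fun _ _ => by positivity) (Finset.mem_range.2 ht)
    linarith
  have hN1 : (1 : ℝ) ≤ N := by exact_mod_cast (by omega : 1 ≤ N)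
  have hNS : 1 ≤ N * (1 + S) := one_le_mul_of_one_le_of_one_le hN1 (by linarith)
  refine ⟨1 + (N * (1 + S)) ^ N, fun a b T hT hTp hab k u hu => ?_⟩
  have hpos : 0 ≤ (N * (1 + S)) ^ N := by positivity
  have hT1 : 1 ≤ T := by linarith
  have hT0 : 0 < T := by linarith
  have hTS : (N * (1 + S)) ^ N ≤ T := by linarith
  have hk : k ≤ N := by simpa using hu.fintype_card_le_finrank
  have : NeZero N := ⟨by omega⟩
  have hpa := sq_le_prime_pow a b hN hT1 hTp hab
  let O : Fin N := 0
  let E : Fin N := ⟨1, by omega⟩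
  have hO : ‖weight p a b N O‖ = (p : ℝ) ^ a := norm_weight_zero a b
  have hE : ‖weight p a b N E‖ = (p : ℝ) ^ b := norm_weight_one a b rfl
  have hOE : O ≠ E := by simp [O, E, Fin.ext_iff]
  have hpair : ∏ j ∈ {O, E}, ‖weight p a b N j‖ = T ^ N := by
    rw [Finset.prod_pair hOE, hO, hE, hTp, pow_add]
  rcases Nat.eq_zero_or_pos k with rfl | hk0
  · refine ⟨_, hfb 0, ?_⟩
    have h := norm_prod_weight_le (p := p) a b hT0 u (f 0) Fin.elim0 zero_le_one (by
      rw [one_mul]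
      refine le_trans (le_of_eq ?_) (norm_det_le_maxMinor (u.map (Int.cast : ℤ → ℝ)) Fin.elim0)
      simp) (by simp)
    simpa using h
  rcases hk.eq_or_lt with rfl | hkN
  · refine ⟨_, hfb 0, ?_⟩
    have hdet : u.det ≠ 0 := by
      have h1 : (u.map (Int.cast : ℤ → ℚ)).det ≠ 0 := by
        rw [← isUnit_iff_ne_zero, ← Matrix.isUnit_iff_isUnit_det,
          ← Matrix.linearIndependent_rows_iff_isUnit]
        exact hu
      intro h0
      apply h1
      have := (Int.castRingHom ℚ).map_det u
      rw [h0, map_zero] at this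
      exact this.symm
    have h := norm_prod_weight_le (p := p) a b hT0 u (f 0) id zero_le_one (by
      rw [Matrix.submatrix_id_id, Matrix.det_mul, det_taylorMatrix, mul_one, one_mul]
      refine le_trans (le_of_eq ?_) (norm_det_le_maxMinor (u.map (Int.cast : ℤ → ℝ)) id)
      rw [Matrix.submatrix_id_id, ← Real.norm_eq_abs]
      congr 1
      exact (Int.castRingHom ℝ).map_det u) (by
      rw [Matrix.submatrix_id_id, Matrix.det_mul, det_taylorMatrix, mul_one]; exact hdet)
    have h2 := prod_norm_weight_le (p := p) a b (I := id) (fun _ _ h => h)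
      (t := {O, E}) (by simp)
    rw [hpair] at h2
    have h3 := h2.trans h
    rw [mul_one] at h3
    exact le_of_mul_le_mul_left (by simpa using h3) (show 0 < T ^ k by positivity)
  have hrow := fun t => linearIndependent_row_mul_taylor hu (f t)
  have hmap := linearIndependent_vecPoly hu
  have hentry := fun t => mul_taylorMatrix_apply (R := ℚ) u (f t : ℚ)
  rcases (show k = 1 ∨ 1 < k by omega) with hk1 | hk1
  · have hP : (vecPoly (u ⟨0, hk0⟩)).map (Int.castRingHom ℚ) ≠ 0 := hmap.ne_zero _
    obtain ⟨t, ht, hPt⟩ := exists_intCast_eval_ne_zero hP (m := 2 * N)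
      ((natDegree_vecPoly_map_lt (by omega) _).trans (by omega)) hf
    refine ⟨_, hfb t, ?_⟩
    obtain ⟨I, hI, hIs, hD⟩ := Matrix.exists_det_submatrix_ne_zero (hrow t) {O} (by
      rw [linearIndepOn_singleton_iff]
      intro h0
      apply hPt
      have := congrFun h0 ⟨0, hk0⟩
      simpa [Matrix.col_apply, hentry, O] using this)
    refine one_le_covol_of_le a b hT1 u hk (f t) hNS hTS (by linarith) (hfS t ht) I
      (det_intCast_ne_zero hD) ?_
    have h2 := prod_norm_weight_le (p := p) a b hI (t := {O}) (by simpa using hIs)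
    rw [Finset.prod_singleton, hO] at h2
    refine le_trans (le_of_eq ?_) (hpa.trans h2)
    rw [hk1]
  · set P := (vecPoly (u ⟨0, hk0⟩)).map (Int.castRingHom ℚ) with hPdef
    set Q := (vecPoly (u ⟨1, hk1⟩)).map (Int.castRingHom ℚ) with hQdef
    have hw : wronskian P Q ≠ 0 := by
      have h := hmap.comp ![⟨0, hk0⟩, ⟨1, hk1⟩] (by
        intro i j; fin_cases i <;> fin_cases j <;> simp)
      have e : (fun i => (vecPoly (u i)).map (Int.castRingHom ℚ)) ∘ ![⟨0, hk0⟩, ⟨1, hk1⟩] =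
          ![P, Q] := by
        funext i; fin_cases i <;> rfl
      rw [e] at h
      exact Polynomial.wronskian_ne_zero_of_linearIndependent h
    have hdeg := natDegree_wronskian_lt_add hw
    have d1 : P.natDegree < N := natDegree_vecPoly_map_lt (by omega) (u ⟨0, hk0⟩)
    have d2 : Q.natDegree < N := natDegree_vecPoly_map_lt (by omega) (u ⟨1, hk1⟩)
    obtain ⟨t, ht, hPt⟩ := exists_intCast_eval_ne_zero hw (m := 2 * N) (by omega) hf
    refine ⟨_, hfb t, ?_⟩
    obtain ⟨I, hI, hIs, hD⟩ := Matrix.exists_det_submatrix_ne_zero (hrow t) {O, E} (by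
      rw [LinearIndepOn.pair_iff _ hOE]
      intro c d hcd
      have e0 := congrFun hcd ⟨0, hk0⟩
      have e1 := congrFun hcd ⟨1, hk1⟩
      simp only [Pi.add_apply, Pi.smul_apply, Matrix.col_apply, hentry, O, E, Fin.val_zero,
        hasseDeriv_zero', hasseDeriv_one', smul_eq_mul, Pi.zero_apply, ← hPdef, ← hQdef] at e0 e1
      rw [wronskian] at hPt
      simp only [eval_sub, eval_mul] at hPt
      constructor
      · refine (mul_eq_zero.1 (?_ : c * _ = 0)).resolve_right hPt
        linear_combination (derivative Q).eval (f t : ℚ) * e0 - (derivative P).eval (f t : ℚ) * e1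
      · refine (mul_eq_zero.1 (?_ : d * _ = 0)).resolve_right hPt
        linear_combination P.eval (f t : ℚ) * e1 - Q.eval (f t : ℚ) * e0)
    refine one_le_covol_of_le a b hT1 u hk (f t) hNS hTS (by linarith) (hfS t ht) I
      (det_intCast_ne_zero hD) ?_
    have h2 := prod_norm_weight_le (p := p) a b hI (t := {O, E}) (by simpa using hIs)
    rw [hpair] at h2
    exact (pow_le_pow_right₀ hT1 (by omega)).trans h2

end Nondegenerate

section LatticeBasis

variable {k m N : ℕ}

/-- The rows of `u` form a `ℤ`-basis of the integer vectors in the rational subspace `W`. -/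
structure IsLatticeBasis (W : Submodule ℚ (Fin N → ℚ)) (u : Matrix (Fin k) (Fin N) ℤ) : Prop where
  linearIndependent : LinearIndependent ℚ fun i => ratVec (u i)
  span_eq : Submodule.span ℚ (Set.range fun i => ratVec (u i)) = W
  exists_vecMul : ∀ v : Fin N → ℤ, ratVec v ∈ W → ∃ c : Fin k → ℤ, v = Matrix.vecMul c u

lemma IsLatticeBasis.finrank_eq {W : Submodule ℚ (Fin N → ℚ)} {u : Matrix (Fin k) (Fin N) ℤ}
    (h : IsLatticeBasis W u) : Module.finrank ℚ W = k := by
  rw [← h.span_eq, finrank_span_eq_card h.linearIndependent, Fintype.card_fin]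

/-- The embedding of integer vectors in rational vectors. -/
def ratVecHom (N : ℕ) : (Fin N → ℤ) →ₗ[ℤ] (Fin N → ℚ) where
  toFun := ratVec
  map_add' v w := by ext; simp [ratVec]
  map_smul' c v := by ext; simp [ratVec]

lemma ratVec_injective : Function.Injective (ratVec (N := N)) := by
  intro v w h
  ext i
  have := congrFun h i
  simpa [ratVec] using this

lemma exists_smul_eq_ratVec (w : Fin N → ℚ) :
    ∃ (d : ℤ) (v : Fin N → ℤ), d ≠ 0 ∧ (d : ℚ) • w = ratVec v := by
  obtain ⟨d, hd⟩ := IsLocalization.exist_integer_multiples_of_finite (nonZeroDivisors ℤ) w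
  choose v hv using hd
  refine ⟨d, v, nonZeroDivisors.coe_ne_zero d, ?_⟩
  ext i
  have := hv i
  simp only [Pi.smul_apply, ratVec, smul_eq_mul] at this ⊢
  simpa using this.symm

lemma exists_isLatticeBasis (W : Submodule ℚ (Fin N → ℚ)) :
    ∃ u : Matrix (Fin (Module.finrank ℚ W)) (Fin N) ℤ, IsLatticeBasis W u := by
  let M : Submodule ℤ (Fin N → ℤ) := (W.restrictScalars ℤ).comap (ratVecHom N)
  let e := Module.finBasis ℤ M
  let u : Matrix (Fin (Module.finrank ℤ M)) (Fin N) ℤ := fun i => (e i : Fin N → ℤ)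
  have hu : IsLatticeBasis W u := by
    refine ⟨?_, ?_, ?_⟩
    · have h1 : LinearIndependent ℤ fun i => ratVec (u i) :=
        (e.linearIndependent.map' M.subtype (Submodule.ker_subtype M)).map' (ratVecHom N)
          (LinearMap.ker_eq_bot.2 ratVec_injective)
      exact (LinearIndependent.iff_fractionRing ℤ ℚ).1 h1
    · refine le_antisymm (Submodule.span_le.2 ?_) fun w hw => ?_
      · rintro _ ⟨i, rfl⟩
        exact (e i).2
      · obtain ⟨d, v, hd, hv⟩ := exists_smul_eq_ratVec w
        have hvM : v ∈ M := by
          change ratVec v ∈ W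
          rw [← hv]; exact W.smul_mem _ hw
        have h1 : v = ∑ i, e.repr ⟨v, hvM⟩ i • u i := by
          have h0 : v = ((∑ i, e.repr ⟨v, hvM⟩ i • e i : M) : Fin N → ℤ) := by rw [e.sum_repr]
          conv_lhs => rw [h0]
          rw [Submodule.coe_sum]
          rfl
        have h2 : ratVec v ∈ Submodule.span ℚ (Set.range fun i => ratVec (u i)) := by
          have h3 : ratVec v = ∑ i, (e.repr ⟨v, hvM⟩ i : ℚ) • ratVec (u i) := by
            conv_lhs => rw [h1]
            ext j
            simp [ratVec]
          rw [h3]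
          exact Submodule.sum_mem _ fun i _ => Submodule.smul_mem _ _
            (Submodule.subset_span ⟨i, rfl⟩)
        rw [← hv] at h2
        exact (Submodule.smul_mem_iff _ (by exact_mod_cast hd)).1 h2
    · intro v hv
      refine ⟨fun i => e.repr ⟨v, hv⟩ i, ?_⟩
      have h0 : v = ((∑ i, e.repr ⟨v, hv⟩ i • e i : M) : Fin N → ℤ) := by rw [e.sum_repr]
      rw [Matrix.vecMul_eq_sum]
      conv_lhs => rw [h0]
      rw [Submodule.coe_sum]
      rfl
  have h := hu.finrank_eq
  rw [h]
  exact ⟨u, hu⟩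

end LatticeBasis

section Short

variable {p : ℕ} [Fact p.Prime] (a b : ℕ) {T : ℝ} {k m N : ℕ}

/-- The Taylor coefficients at `x` of the polynomial with coefficients `v` have norms at most
`p ^ (-a), p ^ (-b), 1, …, 1`. -/
def IsShort (x : ℚ_[p]) (v : Fin N → ℤ) : Prop :=
  ∀ j, ‖Matrix.vecMul (fun i => (v i : ℚ_[p])) (taylorMatrix N x) j * weight p a b N j‖ ≤ 1

lemma covol_sup_span_le (hT : 0 < T) {W : Submodule ℚ (Fin N → ℚ)} {v : Fin N → ℤ}
    (hv : ratVec v ∉ W) {u : Matrix (Fin k) (Fin N) ℤ} (hu : IsLatticeBasis W u)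
    {u' : Matrix (Fin m) (Fin N) ℤ} (hu' : IsLatticeBasis (W ⊔ Submodule.span ℚ {ratVec v}) u')
    {x : ℚ_[p]} (hx : IsShort a b x v) {h : ℝ} (h0 : 0 ≤ h) (hvh : ∀ i, |(v i : ℝ)| ≤ h) :
    covol p a b T u' x ≤ N ^ 2 * (h / T) * covol p a b T u x := by
  let w : Matrix (Fin (k + 1)) (Fin N) ℤ := Fin.cons v u
  have hw : LinearIndependent ℚ fun i => ratVec (w i) := by
    have h1 : (fun i => ratVec (w i)) = Fin.cons (ratVec v) (fun i => ratVec (u i)) := by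
      funext i
      refine Fin.cases rfl (fun i => rfl) i
    rw [h1, linearIndependent_finCons, hu.span_eq]
    exact ⟨hu.linearIndependent, hv⟩
  have hspan : Submodule.span ℚ (Set.range fun i => ratVec (w i)) =
      W ⊔ Submodule.span ℚ {ratVec v} := by
    have h1 : (fun i => ratVec (w i)) = Fin.cons (ratVec v) (fun i => ratVec (u i)) := by
      funext i
      refine Fin.cases rfl (fun i => rfl) i
    rw [h1, Fin.range_cons, Submodule.span_insert, hu.span_eq, sup_comm]
  have hm : m = k + 1 := by
    rw [← hu'.finrank_eq, ← hspan, finrank_span_eq_card hw, Fintype.card_fin]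
  subst hm
  have hkN : k + 1 ≤ N := by simpa using hw.fintype_card_le_finrank
  have hwW : ∀ i, ratVec (w i) ∈ W ⊔ Submodule.span ℚ {ratVec v} := fun i => by
    rw [← hspan]; exact Submodule.subset_span ⟨i, rfl⟩
  choose A hA using fun i => hu'.exists_vecMul (w i) (hwW i)
  have hAw : w = Matrix.of A * u' := by
    funext i
    rw [hA i]
    rfl
  have hdet : (Matrix.of A).det ≠ 0 := by
    intro h0
    obtain ⟨c, hc, hcA⟩ := Matrix.exists_vecMul_eq_zero_iff.2 h0
    have h1 : Matrix.vecMul c w = 0 := by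
      rw [hAw, ← Matrix.vecMul_vecMul, hcA, Matrix.zero_vecMul]
    apply hc
    have h2 := Fintype.linearIndependent_iff.1 hw (fun i => (c i : ℚ)) (by
      ext j
      have := congrFun h1 j
      have h3 : ((∑ i, c i * w i j : ℤ) : ℚ) = 0 := by exact_mod_cast this
      push_cast at h3
      simpa [ratVec] using h3)
    ext i
    exact_mod_cast h2 i
  have h1 := covol_le_mul_left (p := p) a b hT hdet u' x
  rw [← hAw] at h1
  have h2 := covol_succ_le (p := p) a b hT w x h0 hvh (fun j => by
    have := hx j
    have e : weightedTaylor p a b w x 0 j =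
        Matrix.vecMul (fun i => (v i : ℚ_[p])) (taylorMatrix N x) j * weight p a b N j := by
      rw [weightedTaylor, Matrix.mul_diagonal]
      rfl
    rwa [e])
  have h3 : w.submatrix Fin.succ id = u := rfl
  rw [h3] at h2
  refine h1.trans (h2.trans ?_)
  have := covol_nonneg (p := p) a b hT u x
  have hk : ((k : ℝ) + 1) ≤ N := by exact_mod_cast hkN
  gcongr

lemma covol_fin_zero (u : Matrix (Fin 0) (Fin N) ℤ) (x : ℚ_[p]) : covol p a b T u x = 1 := by
  have h : ∀ {K : Type} [NormedField K] (M : Matrix (Fin 0) (Fin N) K), maxMinor M = 1 := by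
    intro K _ M
    refine le_antisymm (maxMinor_le zero_le_one fun I => by simp) ?_
    simpa using norm_det_le_maxMinor M Fin.elim0
  rw [covol, h, h]; simp

lemma not_isShort_of_isMarked (hT : 0 < T)
    {u : ∀ W : Submodule ℚ (Fin N → ℚ), Matrix (Fin (Module.finrank ℚ W)) (Fin N) ℤ}
    (hu : ∀ W, IsLatticeBasis W (u W)) {ε h : ℝ} (hε1 : ε ≤ 1) (h0 : 0 ≤ h)
    (hh : N ^ 2 * (h / T) < ε) {x : ℚ_[p]}
    (hx : IsMarked (fun W => covol p a b T (u W)) ε Set.univ x) {v : Fin N → ℤ} (hv : v ≠ 0)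
    (hvh : ∀ i, |(v i : ℝ)| ≤ h) : ¬ IsShort a b x v := by
  intro hs
  obtain ⟨F, -, hch, hF, hcomp⟩ := hx
  let A : Set (Submodule ℚ (Fin N → ℚ)) := {W | W ∈ insert ⊥ F ∧ ratVec v ∉ W}
  have hA : (⊥ : Submodule ℚ (Fin N → ℚ)) ∈ A := by
    refine ⟨Set.mem_insert _ _, fun h => hv ?_⟩
    rw [Submodule.mem_bot] at h
    apply ratVec_injective
    rw [h]; ext; simp [ratVec]
  obtain ⟨W, ⟨hWF, hvW⟩, hmax⟩ := (wellFounded_gt (α := Submodule ℚ (Fin N → ℚ))).has_min A ⟨_, hA⟩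
  set W' := W ⊔ Submodule.span ℚ {ratVec v} with hW'
  have hcov1 : covol p a b T (u W) x ≤ 1 := by
    rcases hWF with rfl | hWF
    · have : ∀ (m : ℕ) (u : Matrix (Fin m) (Fin N) ℤ), m = 0 → covol p a b T u x = 1 := by
        rintro m u rfl; exact covol_fin_zero a b u x
      exact (this _ _ (by simp)).le
    · exact (hF W hWF).2
  have hle : covol p a b T (u W') x < ε := by
    refine lt_of_le_of_lt (covol_sup_span_le a b hT hvW (hu W) (hu W') hs h0 hvh) ?_
    refine lt_of_le_of_lt (mul_le_of_le_one_right (by positivity) hcov1) hh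
  by_cases hWF' : W' ∈ F
  · exact absurd (hF W' hWF').1 (not_le.2 hle)
  · refine absurd (hcomp W' (Set.mem_univ _) hWF' fun G hG => ?_) (not_le.2 (hle.trans_le hε1))
    have hGW : G ≤ W ∨ W ≤ G := by
      rcases hWF with rfl | hWF
      · exact Or.inr bot_le
      · exact hch G hG W hWF
    by_cases hvG : ratVec v ∈ G
    · refine Or.inr (sup_le (hGW.resolve_left fun h => hvW (h hvG)) ?_)
      simpa using hvG
    · left
      refine le_trans ?_ le_sup_left
      rcases hGW with h | h
      · exact h
      · rcases h.eq_or_lt with h | h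
        · exact h.ge
        · exact absurd h (hmax G ⟨Set.mem_insert_of_mem _ hG, hvG⟩)

theorem measure_short_le (μ : Measure ℚ_[p]) [μ.IsAddHaarMeasure] (hN : 3 ≤ N) {η : ENNReal}
    (hη : η ≠ 0) : ∃ ε : ℝ, 0 < ε ∧ ∀ (x : ℚ_[p]) (j : ℕ), ‖x‖ ≤ 1 → ∃ T₀ : ℝ,
      ∀ (a b : ℕ) (T : ℝ), T₀ ≤ T → T ^ N = (p : ℝ) ^ (a + b) → 2 * b ≤ a →
        μ {y ∈ pball x j | ∃ v : Fin N → ℤ, v ≠ 0 ∧ (∀ i, |(v i : ℝ)| ≤ ε * T) ∧ IsShort a b y v} ≤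
          η * μ (pball x j) := by
  let K : ENNReal := ((N + 1) * p ^ (N + 1) : ℕ) * (N * N : ℕ)
  have hK : K ≠ ⊤ := ENNReal.mul_ne_top (ENNReal.natCast_ne_top _) (ENNReal.natCast_ne_top _)
  obtain ⟨i, hi⟩ : ∃ i : ℕ, K * ((p : ENNReal) ^ i)⁻¹ ≤ η := by
    have h1 : Filter.Tendsto (fun i : ℕ => K * ((p : ENNReal)⁻¹) ^ i) Filter.atTop (nhds (K * 0)) :=
      ENNReal.Tendsto.const_mul (ENNReal.tendsto_pow_atTop_nhds_zero_of_lt_one (by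
        rw [ENNReal.inv_lt_one]
        exact_mod_cast (Fact.out : p.Prime).one_lt)) (Or.inr hK)
    rw [mul_zero] at h1
    obtain ⟨i, hi⟩ := (h1.eventually (gt_mem_nhds (pos_iff_ne_zero.2 hη))).exists
    refine ⟨i, ?_⟩
    rw [← ENNReal.inv_pow] at hi
    exact hi.le
  have hp1 := (one_lt_prime_cast (p := p)).le
  have hN0 : (0 : ℝ) < N := by exact_mod_cast (by omega : 0 < N)
  set ε : ℝ := ((p : ℝ) ^ (i * (N * N)))⁻¹ with hε
  have hpos : (0 : ℝ) < (p : ℝ) ^ (i * (N * N)) := by have := prime_cast_pos (p := p); positivity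
  have hε0 : 0 < ε := by positivity
  have hε1 : ε ≤ 1 := inv_le_one_of_one_le₀ (one_le_pow₀ hp1)
  refine ⟨ε / (2 * N ^ 2), by positivity, fun x j hx => ?_⟩
  obtain ⟨T₀, hT₀⟩ := exists_one_le_covol (p := p) hN hx j
  refine ⟨max T₀ 1, fun a b T hT hTp hab => ?_⟩
  have hT0 : 0 < T := by have := (le_max_right T₀ 1).trans hT; linarith
  choose u hu using fun W : Submodule ℚ (Fin N → ℚ) => exists_isLatticeBasis W
  have hrk : ∀ W : Submodule ℚ (Fin N → ℚ), Module.finrank ℚ W ≤ N := fun W => by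
    simpa using Submodule.finrank_le W
  have h1 := measure_not_isMarked_le μ
    (rk := fun W : Submodule ℚ (Fin N → ℚ) => Module.finrank ℚ W)
    (fun V W h => Submodule.finrank_lt_finrank_of_lt h)
    (ψ := fun W => covol p a b T (u W))
    (fun W => isClosed_le continuous_const (continuous_covol a b (u W))) (ε := ε)
    (η := ((N * N : ℕ) : ENNReal) * ((p : ENNReal) ^ i)⁻¹)
    (fun W y l h => measure_covol_lt_le a b μ hT0 (Nat.mul_le_mul_right N (hrk W)) (u W) i y l h)
    (N + 1) (Finset.range (N + 1)) (by simp) Set.univ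
    (fun W _ => Finset.mem_range.2 (Nat.lt_succ_of_le (hrk W))) x j
    (fun W _ => hT₀ a b T ((le_max_left _ _).trans hT) hTp hab _ _ (hu W).linearIndependent)
  refine (measure_mono ?_).trans (h1.trans ?_)
  · rintro y ⟨hy, v, hv0, hvh, hvs⟩
    refine ⟨hy, fun hm => ?_⟩
    refine not_isShort_of_isMarked a b hT0 hu hε1 (by positivity) ?_ hm hv0 hvh hvs
    have : (N : ℝ) ^ 2 * (ε / (2 * N ^ 2) * T / T) = ε / 2 := by field_simp
    rw [this]; linarith
  · rw [← mul_assoc]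
    gcongr

end Short

section ShortBasis

variable {p : ℕ} [Fact p.Prime] {a b : ℕ} {T : ℝ} {n N : ℕ}

/-- The `j`-th Taylor coefficient at `x` of the polynomial with coefficients `v`. -/
noncomputable def taylorCoeff (x : ℤ_[p]) (j : ℕ) (v : Fin N → ℤ) : ℤ_[p] :=
  (hasseDeriv j ((vecPoly v).map (Int.castRingHom ℤ_[p]))).eval x

lemma taylorCoeff_add (x : ℤ_[p]) (j : ℕ) (v w : Fin N → ℤ) :
    taylorCoeff x j (v + w) = taylorCoeff x j v + taylorCoeff x j w := by
  simp [taylorCoeff, vecPoly_add]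

lemma taylorCoeff_smul (x : ℤ_[p]) (j : ℕ) (c : ℤ) (v : Fin N → ℤ) :
    taylorCoeff x j (c • v) = c * taylorCoeff x j v := by
  rw [taylorCoeff, taylorCoeff, vecPoly_smul, zsmul_eq_mul, Polynomial.map_mul,
    Polynomial.map_intCast, ← zsmul_eq_mul, map_zsmul, eval_smul, zsmul_eq_mul]

lemma taylorCoeff_sub (x : ℤ_[p]) (j : ℕ) (v w : Fin N → ℤ) :
    taylorCoeff x j (v - w) = taylorCoeff x j v - taylorCoeff x j w := by
  have h : v - w = v + (-1 : ℤ) • w := by simp [sub_eq_add_neg]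
  rw [h, taylorCoeff_add, taylorCoeff_smul]; simp [sub_eq_add_neg]

lemma coe_taylorCoeff (x : ℤ_[p]) (j : Fin N) (v : Fin N → ℤ) :
    (taylorCoeff x j v : ℚ_[p]) =
      Matrix.vecMul (fun i => (v i : ℚ_[p])) (taylorMatrix N (x : ℚ_[p])) j := by
  rw [taylorCoeff, ← vecMul_taylorMatrix]
  simp [Matrix.vecMul, dotProduct, taylorMatrix]

lemma norm_weight_mul_le_one_iff {c : ℕ} {y : ℚ_[p]} :
    ‖y * ((p : ℚ_[p]) ^ c)⁻¹‖ ≤ 1 ↔ ‖y‖ ≤ (p : ℝ) ^ (-(c : ℤ)) := by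
  have := prime_cast_pos (p := p)
  rw [norm_mul, norm_inv, norm_pow, Padic.norm_p, inv_pow, inv_inv, zpow_neg, zpow_natCast,
    ← le_div_iff₀ (by positivity), one_div]

lemma isShort_iff {x : ℤ_[p]} {v : Fin N → ℤ} (hN : 2 ≤ N) : IsShort a b (x : ℚ_[p]) v ↔
    ‖taylorCoeff x 0 v‖ ≤ (p : ℝ) ^ (-(a : ℤ)) ∧ ‖taylorCoeff x 1 v‖ ≤ (p : ℝ) ^ (-(b : ℤ)) := by
  simp only [IsShort, ← coe_taylorCoeff]
  constructor
  · intro h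
    have h0 := h ⟨0, by omega⟩
    have h1 := h ⟨1, by omega⟩
    simp only [weight, if_true, one_ne_zero, if_false, norm_weight_mul_le_one_iff] at h0 h1
    exact ⟨h0, h1⟩
  · rintro ⟨h0, h1⟩ j
    unfold weight
    split_ifs with hj0 hj1
    · rw [norm_weight_mul_le_one_iff, hj0]; exact h0
    · rw [norm_weight_mul_le_one_iff, hj1]; exact h1
    · rw [mul_one]; exact PadicInt.norm_le_one _

lemma isShort_sub {x : ℤ_[p]} {v w : Fin N → ℤ} (hN : 2 ≤ N)
    (h0 : PadicInt.toZModPow a (taylorCoeff x 0 v) = PadicInt.toZModPow a (taylorCoeff x 0 w))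
    (h1 : PadicInt.toZModPow b (taylorCoeff x 1 v) = PadicInt.toZModPow b (taylorCoeff x 1 w)) :
    IsShort a b (x : ℚ_[p]) (v - w) := by
  have key : ∀ (c : ℕ) (y z : ℤ_[p]), PadicInt.toZModPow c y = PadicInt.toZModPow c z →
      ‖y - z‖ ≤ (p : ℝ) ^ (-(c : ℤ)) := by
    intro c y z h
    rw [PadicInt.norm_le_pow_iff_mem_span_pow, ← PadicInt.ker_toZModPow, RingHom.mem_ker,
      map_sub, h, sub_self]
  rw [isShort_iff hN, taylorCoeff_sub, taylorCoeff_sub]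
  exact ⟨key _ _ _ h0, key _ _ _ h1⟩

lemma exists_short_mem_ker (hn : 1 ≤ n) {ε : ℝ} (hε : 0 < ε) {C : ℕ} (hC : 0 < C)
    (hCε : (n / ε + 1) ^ n ≤ C) (x : ℤ_[p]) (hT : 0 < T)
    (hTp : T ^ (n + 1) = (p : ℝ) ^ (a + b)) (j₀ : Fin (n + 1)) :
    ∃ w : Fin (n + 1) → ℤ, w ≠ 0 ∧ IsShort a b (x : ℚ_[p]) w ∧ (∀ i, |(w i : ℝ)| ≤ C * T) ∧
      ∀ i, i ≠ j₀ → |(w i : ℝ)| < ε * T / n := by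
  classical
  have hn0 : (0 : ℝ) < n := by exact_mod_cast hn
  set M : ℕ := ⌊C * T⌋₊ with hM
  set δ : ℝ := ε * T / n with hδ
  have hδ0 : 0 < δ := by positivity
  have hCT : 0 ≤ C * T := by positivity
  let s : Finset (Fin (n + 1) → ℤ) := Fintype.piFinset fun _ => Finset.Icc (0 : ℤ) M
  have hs : ∀ v ∈ s, ∀ i, 0 ≤ v i ∧ (v i : ℝ) ≤ C * T := by
    intro v hv i
    have := Finset.mem_Icc.1 (Fintype.mem_piFinset.1 hv i)
    refine ⟨this.1, le_trans ?_ (Nat.floor_le hCT)⟩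
    exact_mod_cast this.2
  have hcard : C ^ (n + 1) * p ^ (a + b) < s.card := by
    have h1 : s.card = (M + 1) ^ (n + 1) := by simp [s]
    rw [h1]
    have h2 : (C * T) ^ (n + 1) < ((M : ℝ) + 1) ^ (n + 1) :=
      pow_lt_pow_left₀ (Nat.lt_floor_add_one _) hCT (by omega)
    rw [mul_pow, hTp] at h2
    exact_mod_cast h2
  let D : ℕ := ⌊C * T / δ⌋₊ + 1
  have hD : D ^ n ≤ C ^ (n + 1) := by
    have h1 : (D : ℝ) ≤ C * (n / ε + 1) := by
      have h2 : (⌊C * T / δ⌋₊ : ℝ) ≤ C * T / δ := Nat.floor_le (by positivity)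
      have h3 : C * T / δ = C * (n / ε) := by rw [hδ]; field_simp
      have h4 : (1 : ℝ) ≤ C := by exact_mod_cast hC
      push_cast [D]
      rw [h3] at h2
      rw [h3]
      linarith
    have h2 : (D : ℝ) ^ n ≤ (C : ℝ) ^ (n + 1) := by
      calc (D : ℝ) ^ n ≤ (C * (n / ε + 1)) ^ n := by gcongr
        _ = C ^ n * (n / ε + 1) ^ n := mul_pow _ _ _
        _ ≤ C ^ n * C := by gcongr
        _ = _ := (pow_succ _ _).symm
    exact_mod_cast h2
  have : NeZero p := ⟨(Fact.out : p.Prime).ne_zero⟩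
  let Φ : (Fin (n + 1) → ℤ) → ZMod (p ^ a) × ZMod (p ^ b) := fun v =>
    (PadicInt.toZModPow a (taylorCoeff x 0 v), PadicInt.toZModPow b (taylorCoeff x 1 v))
  obtain ⟨y, -, hy⟩ := Finset.exists_lt_card_fiber_of_mul_lt_card_of_maps_to (s := s)
    (t := Finset.univ) (f := Φ) (n := C ^ (n + 1)) (fun _ _ => Finset.mem_univ _) (by
      rw [Finset.card_univ, Fintype.card_prod, ZMod.card, ZMod.card, ← pow_add, mul_comm]
      exact hcard)
  let Ψ : (Fin (n + 1) → ℤ) → (Fin (n + 1) → ℕ) := fun v i =>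
    if i = j₀ then 0 else ⌊(v i : ℝ) / δ⌋₊
  let t : Finset (Fin (n + 1) → ℕ) :=
    Fintype.piFinset fun i => if i = j₀ then {0} else Finset.range D
  have ht : t.card = D ^ n := by
    have h1 : t.card = ∏ i : Fin (n + 1), if i = j₀ then 1 else D := by
      simp only [t, Fintype.card_piFinset]
      refine Finset.prod_congr rfl fun i _ => ?_
      split_ifs <;> simp
    rw [h1, Finset.prod_ite, Finset.prod_const_one, one_mul, Finset.prod_const,
      Finset.filter_ne', Finset.card_erase_of_mem (Finset.mem_univ _)]
    simp
  obtain ⟨v, hv, w, hw, hvw, hΨ⟩ := Finset.exists_ne_map_eq_of_card_lt_of_maps_to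
    (s := s.filter fun v => Φ v = y) (t := t) (f := Ψ) (by omega) (by
      intro v hv
      have hv' := hs v (Finset.mem_filter.1 hv).1
      refine Fintype.mem_piFinset.2 fun i => ?_
      by_cases hi : i = j₀
      · simp [Ψ, hi]
      · simp only [Ψ, hi, if_false, Finset.mem_range, D]
        refine Nat.lt_succ_of_le (Nat.floor_le_floor ?_)
        have := (hv' i).2
        gcongr)
  obtain ⟨hvs, hvΦ⟩ := Finset.mem_filter.1 hv
  obtain ⟨hws, hwΦ⟩ := Finset.mem_filter.1 hw
  have hΦ : Φ v = Φ w := hvΦ.trans hwΦ.symm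
  refine ⟨v - w, sub_ne_zero.2 hvw, isShort_sub (by omega) (congrArg Prod.fst hΦ)
    (congrArg Prod.snd hΦ), fun i => ?_, fun i hi => ?_⟩
  · have h1 := hs v hvs i
    have h2 := hs w hws i
    have h3 : (0 : ℝ) ≤ v i := by exact_mod_cast h1.1
    have h4 : (0 : ℝ) ≤ w i := by exact_mod_cast h2.1
    rw [Pi.sub_apply, Int.cast_sub, abs_le]
    constructor <;> linarith
  · have h1 := congrFun hΨ i
    simp only [Ψ, hi, if_false] at h1
    have e1 : (0 : ℝ) ≤ v i / δ := div_nonneg (by exact_mod_cast (hs v hvs i).1) hδ0.le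
    have e2 : (0 : ℝ) ≤ w i / δ := div_nonneg (by exact_mod_cast (hs w hws i).1) hδ0.le
    have f1 := Nat.floor_le e1
    have f2 := Nat.floor_le e2
    have f3 := Nat.lt_floor_add_one ((v i : ℝ) / δ)
    have f4 := Nat.lt_floor_add_one ((w i : ℝ) / δ)
    rw [h1] at f1 f3
    have h2 : |(v i : ℝ) / δ - w i / δ| < 1 := by
      rw [abs_lt]; constructor <;> linarith
    rw [← sub_div, abs_div, abs_of_pos hδ0, div_lt_one hδ0] at h2
    simpa using h2

lemma exists_short_basis (hn : 1 ≤ n) {ε : ℝ} (hε : 0 < ε) : ∃ C : ℕ, 0 < C ∧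
    ∀ (x : ℤ_[p]) (a b : ℕ) (T : ℝ), 0 < T → T ^ (n + 1) = (p : ℝ) ^ (a + b) →
      (∀ v : Fin (n + 1) → ℤ, v ≠ 0 → (∀ i, |(v i : ℝ)| ≤ ε * T) → ¬ IsShort a b (x : ℚ_[p]) v) →
      ∃ P : Matrix (Fin (n + 1)) (Fin (n + 1)) ℤ, P.det ≠ 0 ∧
        (∀ i, IsShort a b (x : ℚ_[p]) (P i)) ∧ ∀ i j, |(P i j : ℝ)| ≤ C * T := by
  obtain ⟨C, hC⟩ := exists_nat_ge ((n / ε + 1) ^ n)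
  have hpos : 0 < (n / ε + 1) ^ n := by positivity
  have hC0 : 0 < C := by exact_mod_cast hpos.trans_le hC
  refine ⟨C, hC0, fun x a b T hT hTp hx => ?_⟩
  have hn0 : (0 : ℝ) < n := by exact_mod_cast hn
  let S : Set (Fin (n + 1) → ℤ) := {v | IsShort a b (x : ℚ_[p]) v ∧ ∀ i, |(v i : ℝ)| ≤ C * T}
  have hspan : Submodule.span ℚ (ratVec '' S) = ⊤ := by
    by_contra hne
    obtain ⟨f, hf0, hf⟩ := Submodule.exists_dual_map_eq_bot_of_lt_top (lt_top_iff_ne_top.2 hne)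
      inferInstance
    have hfS : ∀ v ∈ S, f (ratVec v) = 0 := fun v hv => by
      have : f (ratVec v) ∈ (Submodule.span ℚ (ratVec '' S)).map f :=
        Submodule.mem_map_of_mem (Submodule.subset_span ⟨v, hv, rfl⟩)
      rwa [hf, Submodule.mem_bot] at this
    let c : Fin (n + 1) → ℚ := fun i => f (Pi.single i 1)
    have hfc : ∀ w : Fin (n + 1) → ℚ, f w = ∑ i, w i * c i := fun w => by
      rw [LinearMap.pi_apply_eq_sum_univ f w]
      refine Finset.sum_congr rfl fun i _ => ?_
      rw [smul_eq_mul]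
      congr 2
      ext j
      simp [Pi.single_apply, eq_comm]
    obtain ⟨j₀, -, hj₀⟩ := Finset.exists_max_image Finset.univ (fun i => |c i|) Finset.univ_nonempty
    have hc0 : c j₀ ≠ 0 := by
      intro h
      apply hf0
      ext w
      have : ∀ i, c i = 0 := fun i => by
        have := hj₀ i (Finset.mem_univ i)
        rw [h, abs_zero] at this
        exact abs_eq_zero.1 (le_antisymm this (abs_nonneg _))
      simpa using this w
    obtain ⟨w, hw0, hws, hwC, hwε⟩ := exists_short_mem_ker hn hε hC0 hC x hT hTp j₀
    refine hx w hw0 (fun i => ?_) hws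
    have hle : ε * T / n ≤ ε * T := div_le_self (by positivity) (by exact_mod_cast hn)
    by_cases hi : i = j₀
    · subst hi
      have h1 := hfS w ⟨hws, hwC⟩
      rw [hfc, ← Finset.add_sum_erase _ _ (Finset.mem_univ i)] at h1
      have h2 : |(w i : ℚ)| * |c i| ≤ (∑ j ∈ Finset.univ.erase i, |(w j : ℚ)|) * |c i| := by
        rw [← abs_mul, Finset.sum_mul]
        have : (w i : ℚ) * c i = - ∑ j ∈ Finset.univ.erase i, ratVec w j * c j := by
          rw [eq_neg_iff_add_eq_zero]; exact h1
        rw [this, abs_neg]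
        refine (Finset.abs_sum_le_sum_abs _ _).trans (Finset.sum_le_sum fun j _ => ?_)
        rw [abs_mul]
        exact mul_le_mul_of_nonneg_left (hj₀ j (Finset.mem_univ j)) (abs_nonneg _)
      have h3 := le_of_mul_le_mul_right h2 (abs_pos.2 hc0)
      have h4 : |(w i : ℝ)| ≤ ∑ j ∈ Finset.univ.erase i, |(w j : ℝ)| := by exact_mod_cast h3
      refine h4.trans ?_
      calc _ ≤ ∑ _j ∈ Finset.univ.erase i, ε * T / n :=
            Finset.sum_le_sum fun j hj => (hwε j (Finset.ne_of_mem_erase hj)).le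
        _ = ε * T := by
            rw [Finset.sum_const, Finset.card_erase_of_mem (Finset.mem_univ _)]
            simp
            field_simp
    · exact (hwε i hi).le.trans hle
  obtain ⟨g, hgS, -, hg⟩ := Submodule.exists_fun_fin_finrank_span_eq ℚ (ratVec '' S)
  have hfin : Module.finrank ℚ (Submodule.span ℚ (ratVec '' S)) = n + 1 := by
    rw [hspan, finrank_top]; simp
  choose P hP using fun i : Fin (n + 1) => hgS (finCongr hfin.symm i)
  refine ⟨P, ?_, fun i => (hP i).1.1, fun i => (hP i).1.2⟩
  have hli : LinearIndependent ℚ fun i => ratVec (P i) := by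
    have := hg.comp (finCongr hfin.symm) (finCongr hfin.symm).injective
    have he : (fun i => ratVec (P i)) = g ∘ finCongr hfin.symm := funext fun i => (hP i).2
    rw [he]
    exact this
  have h1 : ((Matrix.of P).map (Int.cast : ℤ → ℚ)).det ≠ 0 := by
    rw [← isUnit_iff_ne_zero, ← Matrix.isUnit_iff_isUnit_det,
      ← Matrix.linearIndependent_rows_iff_isUnit]
    exact hli
  intro h0
  apply h1
  have := (Int.castRingHom ℚ).map_det (Matrix.of P)
  change (Matrix.of P).det = 0 at h0
  rw [h0, map_zero] at this
  exact this.symm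

end ShortBasis

section GoodVector

variable {p : ℕ} [Fact p.Prime] {a b : ℕ} {T : ℝ} {n N : ℕ}

lemma isShort_add {x : ℤ_[p]} {v w : Fin N → ℤ} (hN : 2 ≤ N) (hv : IsShort a b (x : ℚ_[p]) v)
    (hw : IsShort a b (x : ℚ_[p]) w) : IsShort a b (x : ℚ_[p]) (v + w) := by
  rw [isShort_iff hN] at hv hw ⊢
  rw [taylorCoeff_add, taylorCoeff_add]
  exact ⟨(PadicInt.nonarchimedean _ _).trans (max_le hv.1 hw.1),
    (PadicInt.nonarchimedean _ _).trans (max_le hv.2 hw.2)⟩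

lemma norm_taylorCoeff_smul_le (x : ℤ_[p]) (j : ℕ) (c : ℤ) (v : Fin N → ℤ) :
    ‖taylorCoeff x j (c • v)‖ ≤ ‖taylorCoeff x j v‖ := by
  rw [taylorCoeff_smul, norm_mul]
  exact mul_le_of_le_one_left (norm_nonneg _) (PadicInt.norm_le_one _)

lemma isShort_smul {x : ℤ_[p]} {v : Fin N → ℤ} (hN : 2 ≤ N) (c : ℤ)
    (hv : IsShort a b (x : ℚ_[p]) v) : IsShort a b (x : ℚ_[p]) (c • v) := by
  rw [isShort_iff hN] at hv ⊢
  exact ⟨(norm_taylorCoeff_smul_le _ _ _ _).trans hv.1,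
    (norm_taylorCoeff_smul_le _ _ _ _).trans hv.2⟩

lemma isShort_sum {ι : Type*} (s : Finset ι) {x : ℤ_[p]} {v : ι → Fin N → ℤ} (hN : 2 ≤ N)
    (hv : ∀ i ∈ s, IsShort a b (x : ℚ_[p]) (v i)) :
    IsShort a b (x : ℚ_[p]) (∑ i ∈ s, v i) := by
  classical
  induction s using Finset.induction_on with
  | empty =>
    intro j
    simp [Matrix.vecMul, dotProduct]
  | insert i s hi ih =>
    rw [Finset.sum_insert hi]
    exact isShort_add hN (hv i (Finset.mem_insert_self _ _))
      (ih fun j hj => hv j (Finset.mem_insert_of_mem hj))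

lemma le_mul_norm_add {c : ℝ} {K : ℕ} {y z : ℤ_[p]} (hy : c ≤ K * ‖y‖) (hz : K * ‖z‖ < c) :
    c ≤ K * ‖y + z‖ := by
  have hne : ‖y‖ ≠ ‖z‖ := fun h => by rw [h] at hy; linarith
  rw [PadicInt.norm_add_eq_max_of_ne hne]
  exact hy.trans (mul_le_mul_of_nonneg_left (le_max_left _ _) (Nat.cast_nonneg _))

lemma exists_norm_det_le {m : ℕ} {G : Matrix (Fin m) (Fin m) ℚ_[p]} (hG : ∀ i j, ‖G i j‖ ≤ 1)
    (j : Fin m) : ∃ i, ‖G.det‖ ≤ ‖G i j‖ := by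
  obtain ⟨σ, -, hσ⟩ := IsUltrametricDist.exists_norm_finsetSum_le_of_nonempty
    (Finset.univ_nonempty (α := Equiv.Perm (Fin m)))
    (fun σ => (Equiv.Perm.sign σ : ℤ) • ∏ i, G (σ i) i)
  refine ⟨σ j, ?_⟩
  rw [Matrix.det_apply]
  refine hσ.trans ?_
  have h1 : ‖(Equiv.Perm.sign σ : ℤ) • ∏ i, G (σ i) i‖ = ∏ i, ‖G (σ i) i‖ := by
    rcases Int.units_eq_one_or (Equiv.Perm.sign σ) with h | h <;> simp [h]
  rw [h1, ← Finset.mul_prod_erase _ _ (Finset.mem_univ j)]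
  exact mul_le_of_le_one_right (norm_nonneg _)
    (Finset.prod_le_one (fun _ _ => norm_nonneg _) fun i _ => hG _ _)

lemma norm_prod_weight (hN : 2 ≤ N) : ‖∏ j, weight p a b N j‖ = (p : ℝ) ^ (a + b) := by
  obtain ⟨m, rfl⟩ : ∃ m, N = m + 2 := ⟨N - 2, by omega⟩
  rw [norm_prod, Fin.prod_univ_succ, Fin.prod_univ_succ, norm_weight_zero,
    norm_weight_one _ _ (by simp), Finset.prod_eq_one, mul_one, pow_add]
  intro i _
  simp [weight]

lemma norm_det_weightedTaylor (hN : 2 ≤ N) (P : Matrix (Fin N) (Fin N) ℤ) (x : ℚ_[p]) :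
    ‖(weightedTaylor p a b P x).det‖ = (p : ℝ) ^ (a + b) * ‖(P.det : ℚ_[p])‖ := by
  have h := (Int.castRingHom ℚ_[p]).map_det P
  rw [weightedTaylor, Matrix.det_mul, Matrix.det_mul, det_taylorMatrix, mul_one,
    Matrix.det_diagonal, norm_mul, norm_prod_weight hN, mul_comm]
  congr 2
  exact h.symm

lemma weightedTaylor_apply (P : Matrix (Fin N) (Fin N) ℤ) (x : ℚ_[p]) (i j : Fin N) :
    weightedTaylor p a b P x i j =
      Matrix.vecMul (fun k => (P i k : ℚ_[p])) (taylorMatrix N x) j * weight p a b N j := by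
  rw [weightedTaylor, Matrix.mul_diagonal]
  rfl

lemma abs_det_le_factorial {P : Matrix (Fin N) (Fin N) ℤ} {c : ℝ}
    (hP : ∀ i j, |(P i j : ℝ)| ≤ c) : |(P.det : ℝ)| ≤ N.factorial * c ^ N := by
  have h := Matrix.det_le (A := P.map (Int.cast : ℤ → ℝ)) (abv := AbsoluteValue.abs) (x := c)
    (fun i j => hP i j)
  have h2 := (Int.castRingHom ℝ).map_det P
  rw [show (P.map (Int.cast : ℤ → ℝ)).det = (P.det : ℝ) from h2.symm] at h
  simpa [nsmul_eq_mul] using h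

lemma exists_modEq {m : ℕ} {P : Matrix (Fin N) (Fin N) ℤ} {d : ℤ} (hP : IsCoprime P.det (m : ℤ))
    (hd : IsCoprime d (m : ℤ)) (hm : 0 < m) (r t : Fin N → ℤ) : ∃ f : Fin N → ℤ,
      (∀ i, 0 ≤ f i ∧ f i < m) ∧ ∀ j, (m : ℤ) ∣ (r + d • ∑ i, f i • P i) j - t j := by
  have : NeZero m := ⟨hm.ne'⟩
  let φ : ℤ →+* ZMod m := Int.castRingHom (ZMod m)
  have hunit : ∀ z : ℤ, IsCoprime z (m : ℤ) → IsUnit (φ z) := fun z hz => by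
    have := hz.map φ
    rw [map_natCast, ZMod.natCast_self] at this
    exact isCoprime_zero_right.1 this
  obtain ⟨δ, hδ⟩ := (hunit d hd).exists_right_inv
  have hPu : IsUnit (P.map φ).det := by
    have := φ.map_det P
    rw [RingHom.mapMatrix_apply] at this
    rw [← this]; exact hunit _ hP
  let g : Fin N → ZMod m := Matrix.vecMul (fun j => δ * φ (t j - r j)) (P.map φ)⁻¹
  have hg : ∀ j, ∑ i, g i * φ (P i j) = δ * φ (t j - r j) := fun j => by
    have h : Matrix.vecMul g (P.map φ) = fun j => δ * φ (t j - r j) := by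
      simp only [g]
      rw [Matrix.vecMul_vecMul, Matrix.nonsing_inv_mul _ hPu, Matrix.vecMul_one]
    exact congrFun h j
  refine ⟨fun i => ((g i).val : ℤ), fun i => ⟨by positivity, Int.ofNat_lt.2 (ZMod.val_lt (g i))⟩,
    fun j => ?_⟩
  rw [← ZMod.intCast_zmod_eq_zero_iff_dvd]
  have h1 : ((r + d • ∑ i, ((g i).val : ℤ) • P i) j - t j : ℤ) =
      r j + d * (∑ i, ((g i).val : ℤ) * P i j) - t j := by
    simp only [Pi.add_apply, Pi.smul_apply, Finset.sum_apply, smul_eq_mul]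
  rw [h1]
  change φ _ = 0
  have h2 : φ (∑ i, ((g i).val : ℤ) * P i j) = δ * φ (t j - r j) := by
    rw [← hg j, map_sum]
    refine Finset.sum_congr rfl fun i _ => ?_
    rw [map_mul, map_natCast, ZMod.natCast_zmod_val]
  rw [map_sub, map_add, map_mul, h2, ← mul_assoc, hδ, one_mul, map_sub]
  ring

/-- The coefficients of `X ^ n + q`. -/
def eisensteinVec (n q : ℕ) : Fin (n + 1) → ℤ := fun i =>
  if (i : ℕ) = n then 1 else if (i : ℕ) = 0 then q else 0

lemma exists_good_short (p : ℕ) [Fact p.Prime] (hn : 2 ≤ n) {ε : ℝ} (hε : 0 < ε) :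
    ∃ K q C : ℕ, 0 < K ∧ q.Prime ∧ 0 < C ∧
    ∀ (x : ℤ_[p]) (a b : ℕ) (T : ℝ), 0 < T → T ^ (n + 1) = (p : ℝ) ^ (a + b) →
      (∀ v : Fin (n + 1) → ℤ, v ≠ 0 → (∀ i, |(v i : ℝ)| ≤ ε * T) → ¬ IsShort a b (x : ℚ_[p]) v) →
      ∃ V : Fin (n + 1) → ℤ, IsShort a b (x : ℚ_[p]) V ∧ (∀ i, |(V i : ℝ)| ≤ C * T) ∧
        (p : ℝ) ^ (-(b : ℤ)) ≤ K * ‖taylorCoeff x 1 V‖ ∧ 1 ≤ K * ‖taylorCoeff x 2 V‖ ∧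
        ∀ i, ((q ^ 2 : ℕ) : ℤ) ∣ V i - eisensteinVec n q i := by
  obtain ⟨C, hC0, hC⟩ := exists_short_basis (p := p) (by omega : 1 ≤ n) hε
  set K : ℕ := (n + 1).factorial * C ^ (n + 1) with hKdef
  have hK0 : 0 < K := by positivity
  obtain ⟨q, hqK, hq⟩ := Nat.exists_infinite_primes (K + p + 1)
  have hp : p.Prime := Fact.out
  have hp0 := prime_cast_pos (p := p)
  refine ⟨K, q, 2 * C + p ^ K * ((n + 1) * (q ^ 2 * C)), hK0, hq, by positivity,
    fun x a b T hT hTp hx => ?_⟩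
  obtain ⟨P, hP0, hPs, hPC⟩ := hC x a b T hT hTp hx
  have hN : 2 ≤ n + 1 := by omega
  have hdet : |(P.det : ℝ)| ≤ K * (p : ℝ) ^ (a + b) := by
    refine (abs_det_le_factorial hPC).trans (le_of_eq ?_)
    rw [mul_pow, hTp, hKdef]; push_cast; ring
  have hnorm := norm_det_weightedTaylor (a := a) (b := b) hN P (x : ℚ_[p])
  have hG1 : ∀ i j, ‖weightedTaylor p a b P (x : ℚ_[p]) i j‖ ≤ 1 := fun i j => by
    rw [weightedTaylor_apply]; exact hPs i j
  have hlow : 1 ≤ K * ‖(weightedTaylor p a b P (x : ℚ_[p])).det‖ := by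
    rw [hnorm, ← mul_assoc]
    exact (one_le_abs_mul_norm hP0).trans (mul_le_mul_of_nonneg_right hdet (norm_nonneg _))
  have hcol : ∀ j, ∃ i, 1 ≤ K * ‖weightedTaylor p a b P (x : ℚ_[p]) i j‖ := fun j => by
    obtain ⟨i, hi⟩ := exists_norm_det_le hG1 j
    exact ⟨i, hlow.trans (by gcongr)⟩
  have hqdet : ¬ (q : ℤ) ∣ P.det := by
    intro hdvd
    have h1 : ‖(P.det : ℚ_[p])‖ ≤ (p : ℝ) ^ (-((a + b : ℕ) : ℤ)) := by
      obtain ⟨i, hi⟩ := exists_norm_det_le hG1 0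
      have h2 := hi.trans (hG1 i 0)
      rw [hnorm] at h2
      rw [zpow_neg, zpow_natCast, ← one_div, le_div_iff₀ (by positivity), mul_comm]
      exact h2
    obtain ⟨m, hm⟩ := (Padic.norm_int_le_pow_iff_dvd _ _).1 h1
    have hqp : IsCoprime (q : ℤ) ((p ^ (a + b) : ℕ) : ℤ) := by
      refine Nat.isCoprime_iff_coprime.2 (Nat.Coprime.pow_right _ ?_)
      exact (Nat.coprime_primes hq hp).2 (by omega)
    have hqm : (q : ℤ) ∣ m := by
      rw [hm] at hdvd; exact hqp.dvd_of_dvd_mul_left (by simpa using hdvd)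
    have hm0 : m ≠ 0 := by rintro rfl; exact hP0 (by simpa using hm)
    have h3 : |(m : ℝ)| ≤ K := by
      rw [hm] at hdet
      push_cast at hdet
      rw [abs_mul, abs_of_pos (by positivity), mul_comm] at hdet
      exact le_of_mul_le_mul_right hdet (by positivity)
    have h4 : |m| ≤ K := by exact_mod_cast h3
    have h5 := Int.le_of_dvd (abs_pos.2 hm0) ((dvd_abs _ _).2 hqm)
    omega
  have hcol1 : ∃ i, (p : ℝ) ^ (-(b : ℤ)) ≤ K * ‖taylorCoeff x 1 (P i)‖ := by
    obtain ⟨i, hi⟩ := hcol ⟨1, by omega⟩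
    refine ⟨i, ?_⟩
    rw [weightedTaylor_apply, ← coe_taylorCoeff, norm_mul, norm_weight_one _ _ rfl, ← mul_assoc] at hi
    rw [zpow_neg, zpow_natCast, ← one_div, div_le_iff₀ (by positivity)]
    exact hi
  have hcol2 : ∃ i, 1 ≤ K * ‖taylorCoeff x 2 (P i)‖ := by
    obtain ⟨i, hi⟩ := hcol ⟨2, by omega⟩
    refine ⟨i, ?_⟩
    rw [weightedTaylor_apply, ← coe_taylorCoeff] at hi
    simpa [weight] using hi
  obtain ⟨R, hRs, hRC, hR1, hR2⟩ : ∃ R : Fin (n + 1) → ℤ, IsShort a b (x : ℚ_[p]) R ∧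
      (∀ i, |(R i : ℝ)| ≤ 2 * C * T) ∧ (p : ℝ) ^ (-(b : ℤ)) ≤ K * ‖taylorCoeff x 1 R‖ ∧
      1 ≤ K * ‖taylorCoeff x 2 R‖ := by
    obtain ⟨i, hi⟩ := hcol1
    obtain ⟨l, hl⟩ := hcol2
    have h2 : ∀ i j, |(P i j : ℝ)| ≤ 2 * C * T := fun i j => by
      have := hPC i j
      have : 0 ≤ C * T := by positivity
      linarith
    by_cases hi2 : 1 ≤ K * ‖taylorCoeff x 2 (P i)‖
    · exact ⟨P i, hPs i, h2 i, hi, hi2⟩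
    by_cases hl1 : (p : ℝ) ^ (-(b : ℤ)) ≤ K * ‖taylorCoeff x 1 (P l)‖
    · exact ⟨P l, hPs l, h2 l, hl1, hl⟩
    refine ⟨P i + P l, isShort_add hN (hPs i) (hPs l), fun j => ?_, ?_, ?_⟩
    · have := hPC i j
      have := hPC l j
      rw [Pi.add_apply, Int.cast_add]
      refine (abs_add_le _ _).trans ?_
      linarith
    · rw [taylorCoeff_add]; exact le_mul_norm_add hi (not_le.1 hl1)
    · rw [taylorCoeff_add, add_comm]; exact le_mul_norm_add hl (not_le.1 hi2)
  have hq2 : ∀ z : ℤ, ¬ (q : ℤ) ∣ z → IsCoprime z ((q ^ 2 : ℕ) : ℤ) := fun z hz => by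
    push_cast
    exact (((Nat.prime_iff_prime_int.1 hq).coprime_iff_not_dvd.2 hz).symm).pow_right
  obtain ⟨f, hf, hfV⟩ := exists_modEq (m := q ^ 2) (P := P) (d := (p : ℤ) ^ K) (hq2 _ hqdet)
    (hq2 _ (by
      intro h
      have := (Nat.prime_iff_prime_int.1 hq).dvd_of_dvd_pow h
      have := (Nat.prime_dvd_prime_iff_eq hq hp).1 (by exact_mod_cast this)
      omega)) (by have := hq.pos; positivity) R (eisensteinVec n q)
  have hsum : IsShort a b (x : ℚ_[p]) (∑ i, f i • P i) :=
    isShort_sum _ hN fun i _ => isShort_smul hN _ (hPs i)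
  have hKp : (K : ℝ) * ((p : ℝ) ^ K)⁻¹ < 1 := by
    rw [← div_eq_mul_inv, div_lt_one (by positivity)]
    exact_mod_cast Nat.lt_pow_self hp.one_lt
  have hsmall : ∀ (j : ℕ) (c : ℝ), 0 < c → ‖taylorCoeff x j (∑ i, f i • P i)‖ ≤ c →
      K * ‖taylorCoeff x j ((p : ℤ) ^ K • ∑ i, f i • P i)‖ < c := fun j c hc h => by
    rw [taylorCoeff_smul, norm_mul]
    push_cast
    rw [norm_pow, PadicInt.norm_p, inv_pow, ← mul_assoc]
    calc _ ≤ (K * ((p : ℝ) ^ K)⁻¹) * c := by gcongr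
      _ < 1 * c := by gcongr
      _ = c := one_mul c
  refine ⟨R + (p : ℤ) ^ K • ∑ i, f i • P i, isShort_add hN hRs (isShort_smul hN _ hsum),
    fun j => ?_, ?_, ?_, hfV⟩
  · have h1 : |((∑ i, f i * P i j : ℤ) : ℝ)| ≤ (n + 1) * (q ^ 2 * (C * T)) := by
      push_cast
      refine (Finset.abs_sum_le_sum_abs _ _).trans ?_
      calc _ ≤ ∑ _i : Fin (n + 1), (q : ℝ) ^ 2 * (C * T) := by
            refine Finset.sum_le_sum fun i _ => ?_
            rw [abs_mul]
            have h2 : |(f i : ℝ)| ≤ (q : ℝ) ^ 2 := by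
              rw [abs_of_nonneg (by exact_mod_cast (hf i).1)]
              exact_mod_cast (hf i).2.le
            exact mul_le_mul h2 (hPC i j) (abs_nonneg _) (by positivity)
        _ = _ := by simp
    have h2 : (R + (p : ℤ) ^ K • ∑ i, f i • P i) j = R j + (p : ℤ) ^ K * ∑ i, f i * P i j := by
      simp [Finset.sum_apply]
    rw [h2, Int.cast_add, Int.cast_mul, Int.cast_pow, Int.cast_natCast]
    refine (abs_add_le _ _).trans ?_
    rw [abs_mul, abs_of_pos (by positivity : (0 : ℝ) < (p : ℝ) ^ K)]
    calc _ ≤ 2 * C * T + (p : ℝ) ^ K * ((n + 1) * (q ^ 2 * (C * T))) := by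
          gcongr
          exact hRC j
      _ = _ := by push_cast; ring
  · rw [taylorCoeff_add]
    exact le_mul_norm_add hR1 (hsmall 1 _ (by positivity) ((isShort_iff hN).1 hsum).2)
  · rw [taylorCoeff_add]
    exact le_mul_norm_add hR2 (hsmall 2 _ one_pos (PadicInt.norm_le_one _))

end GoodVector

section GoodPolynomial

variable {p : ℕ} [Fact p.Prime] {a b : ℕ} {T : ℝ} {n N q : ℕ}

lemma natDegree_vecPoly_eq {V : Fin (n + 1) → ℤ} (hV : V (Fin.last n) ≠ 0) :
    (vecPoly V).natDegree = n := by
  refine natDegree_eq_of_le_of_coeff_ne_zero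
    (natDegree_le_iff_coeff_eq_zero.2 fun i hi => coeff_vecPoly_of_le _ hi) ?_
  have := coeff_vecPoly V (Fin.last n)
  rw [Fin.val_last] at this
  rwa [this]

lemma natDegree_and_irreducible_primPart (hn : 1 ≤ n) (hq : q.Prime) {V : Fin (n + 1) → ℤ}
    (hV : ∀ i, ((q ^ 2 : ℕ) : ℤ) ∣ V i - eisensteinVec n q i) :
    (vecPoly V).natDegree = n ∧ Irreducible (vecPoly V).primPart := by
  have hqp := Nat.prime_iff_prime_int.1 hq
  have hq2 : (q : ℤ) ∣ ((q ^ 2 : ℕ) : ℤ) := ⟨q, by push_cast; ring⟩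
  have hlast : ¬ (q : ℤ) ∣ V (Fin.last n) := by
    intro h
    have h1 := hq2.trans (hV (Fin.last n))
    simp only [eisensteinVec, Fin.val_last, if_true] at h1
    exact hqp.not_isUnit (isUnit_of_dvd_one ((dvd_sub_right h).1 h1))
  have hdeg : (vecPoly V).natDegree = n :=
    natDegree_vecPoly_eq fun h => hlast (h ▸ dvd_zero _)
  have hlow : ∀ i : Fin (n + 1), (i : ℕ) ≠ n → (q : ℤ) ∣ V i := by
    intro i hi
    have h1 := hq2.trans (hV i)
    simp only [eisensteinVec, hi, if_false] at h1
    split_ifs at h1 with h0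
    · exact (dvd_sub_left dvd_rfl).1 h1
    · simpa using h1
  have hzero : ¬ (q : ℤ) ^ 2 ∣ V 0 := by
    intro h
    have h1 := hV 0
    have hn0 : (0 : ℕ) ≠ n := by omega
    simp only [eisensteinVec, Fin.val_zero, hn0, if_false, if_true] at h1
    push_cast at h1
    have h2 : (q : ℤ) ^ 2 ∣ q := (dvd_sub_right h).1 h1
    have h3 : q ^ 2 ∣ q := by exact_mod_cast h2
    have h4 := Nat.le_of_dvd hq.pos h3
    have := hq.two_le
    nlinarith
  have hcoeff : ∀ i : Fin (n + 1), V i = (vecPoly V).content * (vecPoly V).primPart.coeff i :=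
    fun i => by rw [← coeff_C_mul, ← eq_C_content_mul_primPart, coeff_vecPoly]
  have hc : ¬ (q : ℤ) ∣ (vecPoly V).content := fun h =>
    hlast (by rw [hcoeff]; exact h.mul_right _)
  have hdeg' : (vecPoly V).primPart.natDegree = n := by rw [natDegree_primPart, hdeg]
  refine ⟨hdeg, irreducible_of_eisenstein_criterion
    ((Ideal.span_singleton_prime hqp.ne_zero).2 hqp) ?_ ?_ ?_ ?_ (isPrimitive_primPart _)⟩
  · rw [Ideal.mem_span_singleton, leadingCoeff, hdeg']
    intro h
    apply hlast
    rw [hcoeff]; exact h.mul_left _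
  · intro i hi
    have hi' : i < n := by
      rw [← hdeg']; exact coe_lt_degree.1 hi
    rw [Ideal.mem_span_singleton]
    have h1 := hlow ⟨i, by omega⟩ hi'.ne
    rw [hcoeff] at h1
    exact (hqp.dvd_or_dvd h1).resolve_left hc
  · rw [← natDegree_pos_iff_degree_pos, hdeg']; omega
  · rw [Ideal.span_singleton_pow, Ideal.mem_span_singleton]
    intro h
    apply hzero
    rw [hcoeff]; exact h.mul_left _

lemma exists_good_polynomial (p : ℕ) [Fact p.Prime] (hn : 2 ≤ n) {ε : ℝ} (hε : 0 < ε) :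
    ∃ (K : ℕ) (c C : ℝ), 0 < K ∧ 0 < c ∧ 0 < C ∧
    ∀ (x : ℤ_[p]) (a b : ℕ) (T : ℝ), 0 < T → T ^ (n + 1) = (p : ℝ) ^ (a + b) →
      (∀ v : Fin (n + 1) → ℤ, v ≠ 0 → (∀ i, |(v i : ℝ)| ≤ ε * T) → ¬ IsShort a b (x : ℚ_[p]) v) →
      ∃ F : ℤ[X], Irreducible F ∧ F.natDegree = n ∧ c * T ≤ polyHeight F ∧
        (polyHeight F : ℝ) ≤ C * T ∧
        ‖(F.map (Int.castRingHom ℤ_[p])).eval x‖ ≤ K * (p : ℝ) ^ (-(a : ℤ)) ∧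
        (p : ℝ) ^ (-(b : ℤ)) ≤ K * ‖(F.map (Int.castRingHom ℤ_[p])).derivative.eval x‖ ∧
        ‖(F.map (Int.castRingHom ℤ_[p])).derivative.eval x‖ ≤ K * (p : ℝ) ^ (-(b : ℤ)) ∧
        1 ≤ K * ‖(hasseDeriv 2 (F.map (Int.castRingHom ℤ_[p]))).eval x‖ := by
  obtain ⟨K, q, C, hK0, hq, hC0, hgood⟩ := exists_good_short p hn hε
  have hp : p.Prime := Fact.out
  have hp0 := prime_cast_pos (p := p)
  refine ⟨K, ε / p ^ K, C, hK0, by positivity, by exact_mod_cast hC0,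
    fun x a b T hT hTp hx => ?_⟩
  obtain ⟨V, hVs, hVC, hV1, hV2, hVq⟩ := hgood x a b T hT hTp hx
  obtain ⟨hdeg, hirr⟩ := natDegree_and_irreducible_primPart (by omega) hq hVq
  set F := (vecPoly V).primPart with hF
  set m := (vecPoly V).content with hm
  have hFV : vecPoly V = Polynomial.C m * F := eq_C_content_mul_primPart _
  have hN : 2 ≤ n + 1 := by omega
  have hFdeg : F.natDegree = n := by rw [hF, natDegree_primPart, hdeg]
  have hcoeff : ∀ i : Fin (n + 1), V i = m * F.coeff i :=
    fun i => by rw [← coeff_C_mul, ← hFV, coeff_vecPoly]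
  have hm0 : m ≠ 0 := by
    intro h
    rw [h, map_zero, zero_mul] at hFV
    rw [hFV] at hdeg
    simp at hdeg
    omega
  have hFi : ∀ i : Fin (n + 1), |(F.coeff i : ℝ)| ≤ |(V i : ℝ)| := fun i => by
    rw [hcoeff i, Int.cast_mul, abs_mul]
    refine le_mul_of_one_le_left (abs_nonneg _) ?_
    exact_mod_cast Int.one_le_abs hm0
  let D : ℕ → ℤ_[p] := fun j => (hasseDeriv j (F.map (Int.castRingHom ℤ_[p]))).eval x
  have hD : ∀ j, taylorCoeff x j V = m * D j := fun j => by
    rw [taylorCoeff, hFV, Polynomial.map_mul, map_C, ← smul_eq_C_mul, map_smul, eval_smul,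
      smul_eq_mul]
    simp [D]
  have hDn : ∀ j, ‖taylorCoeff x j V‖ = ‖(m : ℤ_[p])‖ * ‖D j‖ := fun j => by
    rw [hD, norm_mul]
  have hmK : 1 ≤ K * ‖(m : ℤ_[p])‖ := by
    refine hV2.trans ?_
    rw [hDn]
    gcongr
    exact mul_le_of_le_one_right (norm_nonneg _) (PadicInt.norm_le_one _)
  have hDle : ∀ j, ‖D j‖ ≤ K * ‖taylorCoeff x j V‖ := fun j => by
    rw [hDn, ← mul_assoc]
    exact le_mul_of_one_le_left (norm_nonneg _) hmK
  have hleD : ∀ j, ‖taylorCoeff x j V‖ ≤ ‖D j‖ := fun j => by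
    rw [hDn]
    exact mul_le_of_le_one_left (norm_nonneg _) (PadicInt.norm_le_one _)
  have hVs' := (isShort_iff hN).1 hVs
  have hD0 : D 0 = (F.map (Int.castRingHom ℤ_[p])).eval x := by
    simp only [D]; rw [hasseDeriv_zero']
  have hD1 : D 1 = (F.map (Int.castRingHom ℤ_[p])).derivative.eval x := by
    simp only [D]; rw [hasseDeriv_one']
  have h0 : ‖D 0‖ ≤ K * (p : ℝ) ^ (-(a : ℤ)) :=
    (hDle 0).trans (mul_le_mul_of_nonneg_left hVs'.1 (Nat.cast_nonneg _))
  have h1 : ‖D 1‖ ≤ K * (p : ℝ) ^ (-(b : ℤ)) :=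
    (hDle 1).trans (mul_le_mul_of_nonneg_left hVs'.2 (Nat.cast_nonneg _))
  refine ⟨F, hirr, hFdeg, ?_, ?_, hD0 ▸ h0, hD1 ▸ ?_, hD1 ▸ h1, ?_⟩
  · let w : Fin (n + 1) → ℤ := fun i => F.coeff i
    have hwF : vecPoly w = F := by
      ext i
      by_cases hi : i < n + 1
      · exact coeff_vecPoly w ⟨i, hi⟩
      · rw [coeff_vecPoly_of_le _ (by omega), coeff_eq_zero_of_natDegree_lt (by omega)]
    have hKp : (K : ℝ) * ((p : ℝ) ^ K)⁻¹ ≤ 1 := by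
      rw [← div_eq_mul_inv, div_le_one (by positivity)]
      exact_mod_cast (Nat.lt_pow_self hp.one_lt).le
    have hsh : ∀ (j c : ℕ), ‖D j‖ ≤ K * (p : ℝ) ^ (-(c : ℤ)) →
        ‖taylorCoeff x j ((p : ℤ) ^ K • w)‖ ≤ (p : ℝ) ^ (-(c : ℤ)) := fun j c h => by
      have h2 : taylorCoeff x j w = D j := by rw [taylorCoeff, hwF]
      rw [taylorCoeff_smul, norm_mul, h2]
      push_cast
      rw [norm_pow, PadicInt.norm_p, inv_pow]
      calc _ ≤ ((p : ℝ) ^ K)⁻¹ * (K * (p : ℝ) ^ (-(c : ℤ))) := by gcongr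
        _ = (K * ((p : ℝ) ^ K)⁻¹) * (p : ℝ) ^ (-(c : ℤ)) := by ring
        _ ≤ 1 * (p : ℝ) ^ (-(c : ℤ)) := by gcongr
        _ = _ := one_mul _
    have hw0 : (p : ℤ) ^ K • w ≠ 0 := by
      refine smul_ne_zero (pow_ne_zero _ (by exact_mod_cast hp.ne_zero)) fun h => ?_
      rw [h] at hwF
      apply hirr.ne_zero
      rw [← hwF]; simp [vecPoly]
    have hnot := mt (hx _ hw0) (not_not.2 ((isShort_iff hN).2 ⟨hsh 0 a h0, hsh 1 b h1⟩))
    push Not at hnot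
    obtain ⟨i, hi⟩ := hnot
    have h2 : |(F.coeff i : ℝ)| ≤ polyHeight F := by
      have : (F.coeff i).natAbs ≤ polyHeight F :=
        Finset.le_sup (f := fun i => (F.coeff i).natAbs)
          (Finset.mem_range.2 (by rw [hFdeg]; exact i.2))
      rw [← Int.cast_abs, Int.abs_eq_natAbs]
      exact_mod_cast this
    rw [div_mul_eq_mul_div, div_le_iff₀ (by positivity)]
    have h3 : |(((p : ℤ) ^ K • w) i : ℝ)| = (p : ℝ) ^ K * |(F.coeff i : ℝ)| := by
      simp [w, abs_mul]
    rw [h3] at hi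
    calc ε * T ≤ (p : ℝ) ^ K * |(F.coeff i : ℝ)| := hi.le
      _ ≤ (p : ℝ) ^ K * polyHeight F := by gcongr
      _ = _ := mul_comm _ _
  · have : polyHeight F ≤ ⌊C * T⌋₊ := by
      refine Finset.sup_le fun i hi => ?_
      rw [hFdeg, Finset.mem_range] at hi
      rw [Nat.le_floor_iff (by positivity)]
      rw [Nat.cast_natAbs, Int.cast_abs]
      exact (hFi ⟨i, hi⟩).trans (hVC ⟨i, hi⟩)
    exact (Nat.cast_le.2 this).trans (Nat.floor_le (by positivity))
  · exact hV1.trans (mul_le_mul_of_nonneg_left (hleD 1) (Nat.cast_nonneg _))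
  · exact hV2.trans (mul_le_mul_of_nonneg_left (hleD 2) (Nat.cast_nonneg _))

end GoodPolynomial

section Roots

lemma Polynomial.hasseDeriv_map {R S : Type*} [Semiring R] [Semiring S] (f : R →+* S) (k : ℕ)
    (P : R[X]) : hasseDeriv k (P.map f) = (hasseDeriv k P).map f := by
  ext; simp [hasseDeriv_coeff]

lemma Polynomial.eval_derivative_X_sub_C_mul {R : Type*} [CommRing R] (α : R) (g : R[X]) :
    (derivative ((X - Polynomial.C α) * g)).eval α = g.eval α := by
  simp [derivative_mul]

lemma Polynomial.eval_hasseDeriv_two_X_sub_C_mul {R : Type*} [CommRing R] (α : R) (g : R[X]) :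
    (hasseDeriv 2 ((X - Polynomial.C α) * g)).eval α = (derivative g).eval α := by
  simp [hasseDeriv_mul, Finset.Nat.sum_antidiagonal_succ, hasseDeriv_X, hasseDeriv_C]

/-- A polynomial with a root `α` at which the derivative is small compared to the second Taylor
coefficient has another root close to `α`. -/
lemma Polynomial.exists_root_near {L : Type*} [NormedField L] [IsAlgClosed L] {f : L[X]} {α : L}
    (hα : f.eval α = 0) (h1 : (derivative f).eval α ≠ 0) (h2 : (hasseDeriv 2 f).eval α ≠ 0) :
    ∃ β, f.eval β = 0 ∧ β ≠ α ∧
      ‖α - β‖ * ‖(hasseDeriv 2 f).eval α‖ ≤ f.natDegree * ‖(derivative f).eval α‖ := by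
  obtain ⟨g, rfl⟩ := dvd_iff_isRoot.2 hα
  rw [eval_derivative_X_sub_C_mul] at h1 ⊢
  rw [eval_hasseDeriv_two_X_sub_C_mul] at h2 ⊢
  have hg0 : g ≠ 0 := by rintro rfl; simp at h1
  have hdeg : ((X - Polynomial.C α) * g).natDegree = 1 + g.natDegree := by
    rw [natDegree_mul (X_sub_C_ne_zero α) hg0, natDegree_X_sub_C]
  by_contra! hcon
  have hroot : ∀ γ ∈ g.roots,
      (1 + g.natDegree : ℝ) * ‖g.eval α‖ < ‖α - γ‖ * ‖(derivative g).eval α‖ := fun γ hγ => by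
    have hγ' : g.eval γ = 0 := (mem_roots'.1 hγ).2
    have := hcon γ (by simp [hγ']) (fun h => h1 (by rw [← h, hγ']))
    rw [hdeg] at this
    exact_mod_cast this
  have hsum := (IsAlgClosed.splits g).eval_derivative_div_eval_of_ne_zero h1
  have hA : 0 < ‖g.eval α‖ := norm_pos_iff.2 h1
  have hB : 0 < ‖(derivative g).eval α‖ := norm_pos_iff.2 h2
  have hd : (0 : ℝ) < 1 + g.natDegree := by positivity
  have hle : ‖(derivative g).eval α / g.eval α‖ ≤
      g.natDegree * (‖(derivative g).eval α‖ / ((1 + g.natDegree) * ‖g.eval α‖)) := by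
    rw [hsum]
    refine (norm_multiset_sum_le _).trans ?_
    rw [Multiset.map_map]
    refine (Multiset.sum_le_card_nsmul _
      (‖(derivative g).eval α‖ / ((1 + g.natDegree) * ‖g.eval α‖)) ?_).trans ?_
    · intro y hy
      obtain ⟨γ, hγ, rfl⟩ := Multiset.mem_map.1 hy
      have h3 := hroot γ hγ
      have h4 : 0 < ‖α - γ‖ := by
        by_contra! h
        have : ‖α - γ‖ * ‖(derivative g).eval α‖ ≤ 0 := mul_nonpos_of_nonpos_of_nonneg h hB.le
        have : 0 < (1 + g.natDegree : ℝ) * ‖g.eval α‖ := by positivity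
        linarith
      simp only [Function.comp, norm_div, norm_one]
      rw [div_le_div_iff₀ h4 (by positivity), one_mul, mul_comm ‖(derivative g).eval α‖]
      exact h3.le
    · rw [Multiset.card_map, nsmul_eq_mul]
      gcongr
      exact_mod_cast g.card_roots'
  rw [norm_div, div_le_iff₀ hA] at hle
  have h5 : g.natDegree * (‖(derivative g).eval α‖ / ((1 + g.natDegree) * ‖g.eval α‖)) *
      ‖g.eval α‖ = (g.natDegree / (1 + g.natDegree)) * ‖(derivative g).eval α‖ := by
    field_simp
  rw [h5] at hle
  have h6 : (g.natDegree / (1 + g.natDegree) : ℝ) < 1 := by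
    rw [div_lt_one hd]; linarith
  nlinarith

variable {p : ℕ} [Fact p.Prime]

lemma exists_root_of_small {G : ℤ_[p][X]} {x : ℤ_[p]} {K a b : ℕ} (hK : 0 < K)
    (h0 : ‖G.eval x‖ ≤ K * (p : ℝ) ^ (-(a : ℤ)))
    (h1 : (p : ℝ) ^ (-(b : ℤ)) ≤ K * ‖G.derivative.eval x‖)
    (h2 : 1 ≤ K * ‖(hasseDeriv 2 G).eval x‖) (hab : (K : ℝ) ^ 3 * p ^ (2 * b) < p ^ a) :
    ∃ α : ℤ_[p], G.eval α = 0 ∧ ‖G.derivative.eval α‖ = ‖G.derivative.eval x‖ ∧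
      1 ≤ K * ‖(hasseDeriv 2 G).eval α‖ ∧ ‖x - α‖ ≤ K ^ 2 * p ^ b / p ^ a := by
  have hp := prime_cast_pos (p := p)
  have hp1 := (one_lt_prime_cast (p := p)).le
  have hK' : (0 : ℝ) < K := by exact_mod_cast hK
  rw [zpow_neg, zpow_natCast] at h0 h1
  have hD : 1 ≤ K * p ^ b * ‖G.derivative.eval x‖ := by
    rw [inv_le_iff_one_le_mul₀ (by positivity)] at h1
    linarith
  have hnorm : ‖G.eval x‖ < ‖G.derivative.eval x‖ ^ 2 := by
    have h3 : 1 ≤ (K * p ^ b * ‖G.derivative.eval x‖) ^ 2 := one_le_pow₀ hD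
    have h4 : (K * ((p : ℝ) ^ a)⁻¹) * (K ^ 2 * p ^ (2 * b)) < 1 := by
      have : (K * ((p : ℝ) ^ a)⁻¹) * (K ^ 2 * p ^ (2 * b)) = (K ^ 3 * p ^ (2 * b)) / p ^ a := by
        field_simp
      rw [this, div_lt_one (by positivity)]
      exact hab
    have h5 : (K * p ^ b * ‖G.derivative.eval x‖) ^ 2 =
        ‖G.derivative.eval x‖ ^ 2 * (K ^ 2 * (p : ℝ) ^ (2 * b)) := by ring
    rw [h5] at h3
    refine h0.trans_lt (lt_of_mul_lt_mul_right (h4.trans_le h3) (by positivity))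
  obtain ⟨α, hα, hαx, hαd, -⟩ := hensels_lemma (F := G) (a := x) (by simpa using hnorm)
  simp only [coe_aeval_eq_eval] at hα hαx hαd
  obtain ⟨k, hk⟩ := binomExpansion G α (x - α)
  rw [add_sub_cancel, hα, zero_add] at hk
  have hfac : G.eval x = (G.derivative.eval α + k * (x - α)) * (x - α) := by rw [hk]; ring
  have hlt : ‖k * (x - α)‖ < ‖G.derivative.eval α‖ := by
    rw [norm_mul, hαd, norm_sub_rev]
    exact (mul_le_of_le_one_left (norm_nonneg _) (PadicInt.norm_le_one _)).trans_lt hαx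
  have hdist : ‖x - α‖ ≤ K ^ 2 * p ^ b / p ^ a := by
    have h3 : ‖G.eval x‖ = ‖G.derivative.eval x‖ * ‖x - α‖ := by
      rw [hfac, norm_mul, PadicInt.norm_add_eq_max_of_ne hlt.ne', max_eq_left hlt.le, hαd]
    have h4 : ‖x - α‖ ≤ (K * p ^ b * ‖G.derivative.eval x‖) * ‖x - α‖ :=
      le_mul_of_one_le_left (norm_nonneg _) hD
    calc ‖x - α‖ ≤ K * p ^ b * ‖G.eval x‖ := by rw [h3]; linarith
      _ ≤ K * p ^ b * (K * ((p : ℝ) ^ a)⁻¹) := by gcongr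
      _ = _ := by field_simp
  refine ⟨α, hα, hαd, ?_, hdist⟩
  obtain ⟨c, hc⟩ := sub_dvd_eval_sub α x (hasseDeriv 2 G)
  have h3 : (hasseDeriv 2 G).eval α = (hasseDeriv 2 G).eval x + (α - x) * c := by
    rw [← hc]; ring
  rw [h3]
  refine le_mul_norm_add h2 ?_
  have h4 : ‖(α - x) * c‖ ≤ ‖x - α‖ := by
    rw [norm_mul, norm_sub_rev]
    exact mul_le_of_le_one_right (norm_nonneg _) (PadicInt.norm_le_one _)
  calc (K : ℝ) * ‖(α - x) * c‖ ≤ K * (K ^ 2 * p ^ b / p ^ a) := by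
        gcongr; exact h4.trans hdist
    _ = (K ^ 3 * p ^ b) / p ^ a := by ring
    _ ≤ (K ^ 3 * p ^ (2 * b)) / p ^ a := by
        gcongr
        omega
    _ < 1 := by rw [div_lt_one (by positivity)]; exact hab

lemma exists_close_roots {L : Type*} [NormedField L] [Algebra ℚ_[p] L] [IsAlgClosed L]
    (hL : ∀ y : ℚ_[p], ‖algebraMap ℚ_[p] L y‖ = ‖y‖) {F : ℤ[X]} {x : ℤ_[p]} {K a b : ℕ}
    (hK : 0 < K) (h0 : ‖(F.map (Int.castRingHom ℤ_[p])).eval x‖ ≤ K * (p : ℝ) ^ (-(a : ℤ)))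
    (h1 : (p : ℝ) ^ (-(b : ℤ)) ≤ K * ‖(F.map (Int.castRingHom ℤ_[p])).derivative.eval x‖)
    (h1' : ‖(F.map (Int.castRingHom ℤ_[p])).derivative.eval x‖ ≤ K * (p : ℝ) ^ (-(b : ℤ)))
    (h2 : 1 ≤ K * ‖(hasseDeriv 2 (F.map (Int.castRingHom ℤ_[p]))).eval x‖)
    (hab : (K : ℝ) ^ 3 * p ^ (2 * b) < p ^ a) :
    ∃ α : ℤ_[p], aeval (α : ℚ_[p]) F = 0 ∧ ‖x - α‖ ≤ K ^ 2 * p ^ b / p ^ a ∧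
      ∃ β : L, aeval β F = 0 ∧ β ≠ algebraMap ℚ_[p] L α ∧
        ‖algebraMap ℚ_[p] L α - β‖ ≤ F.natDegree * K ^ 2 / p ^ b := by
  have hp := prime_cast_pos (p := p)
  have hK' : (0 : ℝ) < K := by exact_mod_cast hK
  obtain ⟨α, hα, hαd, hα2, hdist⟩ := exists_root_of_small hK h0 h1 h2 hab
  let ι : ℤ_[p] →+* L := (algebraMap ℚ_[p] L).comp PadicInt.Coe.ringHom
  have hι : ∀ z, ‖ι z‖ = ‖z‖ := fun z => hL z
  have hmap : (F.map (Int.castRingHom ℤ_[p])).map ι = F.map (Int.castRingHom L) := by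
    rw [Polynomial.map_map]
    congr 1
    exact RingHom.ext_int _ _
  have e0 : (F.map (Int.castRingHom L)).eval (ι α) = 0 := by
    rw [← hmap, eval_map_apply, hα, map_zero]
  have e1 : ‖(F.map (Int.castRingHom L)).derivative.eval (ι α)‖ =
      ‖(F.map (Int.castRingHom ℤ_[p])).derivative.eval x‖ := by
    rw [← hmap, derivative_map, eval_map_apply, hι, hαd]
  have e2 : ‖(hasseDeriv 2 (F.map (Int.castRingHom L))).eval (ι α)‖ =
      ‖(hasseDeriv 2 (F.map (Int.castRingHom ℤ_[p]))).eval α‖ := by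
    rw [← hmap, hasseDeriv_map, eval_map_apply, hι]
  have hpb : 0 < (p : ℝ) ^ (-(b : ℤ)) := by positivity
  obtain ⟨β, hβ, hβα, hle⟩ := exists_root_near e0
    (norm_pos_iff.1 (by rw [e1]; exact pos_of_mul_pos_right (hpb.trans_le h1) hK'.le))
    (norm_pos_iff.1 (by rw [e2]; exact pos_of_mul_pos_right (one_pos.trans_le hα2) hK'.le))
  rw [e1, e2] at hle
  refine ⟨α, ?_, hdist, β, ?_, hβα, ?_⟩
  · have : (F.map (Int.castRingHom ℤ_[p])).map PadicInt.Coe.ringHom =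
        F.map (algebraMap ℤ ℚ_[p]) := by
      rw [Polynomial.map_map]
      congr 1
    rw [aeval_def, ← eval_map, ← this]
    change eval (PadicInt.Coe.ringHom α) _ = 0
    rw [eval_map_apply, hα, map_zero]
  · rw [aeval_def, ← eval_map]; exact hβ
  · change ‖ι α - β‖ ≤ _
    have hdeg : ((F.map (Int.castRingHom L)).natDegree : ℝ) ≤ F.natDegree := by
      exact_mod_cast natDegree_map_le
    calc ‖ι α - β‖ ≤ ‖ι α - β‖ * (K * ‖(hasseDeriv 2 (F.map (Int.castRingHom ℤ_[p]))).eval α‖) :=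
          le_mul_of_one_le_right (norm_nonneg _) hα2
      _ = K * (‖ι α - β‖ * ‖(hasseDeriv 2 (F.map (Int.castRingHom ℤ_[p]))).eval α‖) := by ring
      _ ≤ K * (F.natDegree * (K * (p : ℝ) ^ (-(b : ℤ)))) := by
          refine mul_le_mul_of_nonneg_left (hle.trans ?_) hK'.le
          exact mul_le_mul hdeg h1' (norm_nonneg _) (Nat.cast_nonneg _)
      _ = _ := by rw [zpow_neg, zpow_natCast]; field_simp

end Roots

section Assembly

variable {p : ℕ} [Fact p.Prime]

lemma exists_parameters {N : ℕ} (hN : 1 ≤ N) (M : ℕ) {θ Q : ℝ} (hθ : 0 ≤ θ)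
    (hθN : θ ≤ (N : ℝ) / 3) (hQ : (p : ℝ) ^ M ≤ Q) :
    ∃ (a b : ℕ) (T : ℝ), 0 < T ∧ T ^ N = (p : ℝ) ^ (a + b) ∧ Q / p ≤ T ∧ T ≤ Q ∧
      2 * b + M ≤ a ∧ Q ^ θ ≤ (p : ℝ) ^ (b + M + 1) ∧ (p : ℝ) ^ b ≤ Q ^ θ ∧
      Q ^ N ≤ (p : ℝ) ^ (a + b + 1) := by
  have hp0 := prime_cast_pos (p := p)
  have hp1 := one_lt_prime_cast (p := p)
  have hN0 : (1 : ℝ) ≤ N := by exact_mod_cast hN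
  have hQ0 : 0 < Q := (by positivity : (0 : ℝ) < (p : ℝ) ^ M).trans_le hQ
  set l : ℝ := Real.logb p Q with hl
  have hQl : Q = (p : ℝ) ^ l := (Real.rpow_logb hp0 hp1.ne' hQ0).symm
  have hMl : (M : ℝ) ≤ l := by
    rw [hl, Real.le_logb_iff_rpow_le hp1 hQ0, Real.rpow_natCast]; exact hQ
  have hl0 : 0 ≤ l := (Nat.cast_nonneg M).trans hMl
  have hQθ : ∀ y : ℝ, Q ^ y = (p : ℝ) ^ (l * y) := fun y => by
    rw [Real.rpow_mul hp0.le, ← hQl]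
  set s : ℕ := ⌊N * l⌋₊ with hs
  set t : ℕ := ⌊θ * l⌋₊ with ht
  have hs1 : (s : ℝ) ≤ N * l := Nat.floor_le (by positivity)
  have hs2 : N * l < s + 1 := Nat.lt_floor_add_one _
  have ht1 : (t : ℝ) ≤ θ * l := Nat.floor_le (by positivity)
  have ht2 : θ * l < t + 1 := Nat.lt_floor_add_one _
  have h3t : 3 * t ≤ s := by
    refine Nat.le_floor ?_
    push_cast
    have : θ * l ≤ N / 3 * l := by gcongr
    linarith
  have hMs : M ≤ s := Nat.le_floor (hMl.trans (le_mul_of_one_le_left hl0 hN0))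
  refine ⟨s - (t - M), t - M, (p : ℝ) ^ ((s : ℝ) / N), by positivity, ?_, ?_, ?_, by omega,
    ?_, ?_, ?_⟩
  · rw [← Real.rpow_natCast, ← Real.rpow_mul hp0.le, div_mul_cancel₀ _ (by positivity),
      Real.rpow_natCast]
    congr 1; omega
  · rw [hQl, div_eq_mul_inv, ← Real.rpow_neg_one, ← Real.rpow_add hp0]
    refine Real.rpow_le_rpow_of_exponent_le hp1.le ?_
    rw [le_div_iff₀ (by positivity)]
    nlinarith
  · rw [hQl]
    refine Real.rpow_le_rpow_of_exponent_le hp1.le ?_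
    rw [div_le_iff₀ (by positivity)]
    linarith
  · rw [hQθ, ← Real.rpow_natCast]
    refine Real.rpow_le_rpow_of_exponent_le hp1.le ?_
    have : (t : ℝ) + 1 ≤ ((t - M + M + 1 : ℕ) : ℝ) := by
      exact_mod_cast (by omega : t + 1 ≤ t - M + M + 1)
    linarith
  · rw [hQθ, ← Real.rpow_natCast]
    refine Real.rpow_le_rpow_of_exponent_le hp1.le ?_
    have : ((t - M : ℕ) : ℝ) ≤ t := by exact_mod_cast Nat.sub_le _ _
    linarith
  · rw [← Real.rpow_natCast, hQθ, ← Real.rpow_natCast]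
    refine Real.rpow_le_rpow_of_exponent_le hp1.le ?_
    have : (s : ℝ) + 1 ≤ ((s - (t - M) + (t - M) + 1 : ℕ) : ℝ) := by
      exact_mod_cast (by omega : s + 1 ≤ s - (t - M) + (t - M) + 1)
    linarith

lemma exists_setOf_norm_sub_le_eq_pball (x₀ : ℚ_[p]) {r : ℝ} (hr : 0 < r) (hr1 : r ≤ 1) :
    ∃ j : ℕ, {x : ℚ_[p] | ‖x - x₀‖ ≤ r} = pball x₀ j := by
  have hp1 := one_lt_prime_cast (p := p)
  obtain ⟨k, hk1, hk2⟩ := exists_mem_Ico_zpow hr hp1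
  have hk : k ≤ 0 := by
    by_contra! h
    have := one_lt_zpow₀ hp1 h
    linarith
  obtain ⟨j, rfl⟩ : ∃ j : ℕ, k = -j := ⟨k.natAbs, by omega⟩
  refine ⟨j, Set.ext fun y => ?_⟩
  rw [Set.mem_ofPred_eq, mem_pball]
  refine ⟨fun h => ?_, fun h => h.trans hk1⟩
  rw [Padic.norm_le_pow_iff_norm_lt_pow_add_one]
  exact h.trans_lt hk2

lemma ENNReal.mul_le_of_le_mul_add {κ : ℝ} (hκ0 : 0 ≤ κ) (hκ1 : κ ≤ 1) {A B D : ENNReal}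
    (hB : B ≠ ⊤) (hA : A ≤ ENNReal.ofReal (1 - κ) * B) (h : B ≤ A + D) :
    ENNReal.ofReal κ * B ≤ D := by
  have h1 : ENNReal.ofReal κ * B + ENNReal.ofReal (1 - κ) * B = B := by
    rw [← add_mul, ← ENNReal.ofReal_add hκ0 (by linarith)]
    simp
  have h2 : ENNReal.ofReal κ * B + ENNReal.ofReal (1 - κ) * B ≤
      D + ENNReal.ofReal (1 - κ) * B := by
    rw [h1, add_comm D]
    exact h.trans (add_le_add_left hA D)
  exact ENNReal.le_of_add_le_add_right (ENNReal.mul_ne_top ENNReal.ofReal_ne_top hB) h2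

end Assembly

/-- Let `n ≥ 2`, `p` a prime and `0 < κ < 1`. There are constants
`C₀, C₁, C₂ > 0` (depending only on `n, p, κ`) such that for every `0 ≤ θ ≤ (n+1)/3` and
every ball `B = B(x₀, r) ⊆ ℤ_p`, for all sufficiently large `Q`,
`μ(⋃_{α ∈ 𝔸} B(α, C₀ Q^{−n−1+2θ}) ∩ B) ≥ κ μ(B)`, where `𝔸` is the set of `α ∈ ℤ_p` which
are roots of an irreducible `P ∈ ℤ[X]` of degree `n` with `C₁ Q ≤ H(P) ≤ C₂ Q` having a root
`β` in the algebraic closure of `ℚ_p` with `0 < |α − β|_p ≤ C₀ Q^{−θ}`.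

Here `μ` is the Haar measure on `ℚ_p` normalized so that `μ(ℤ_p) = 1`, and the algebraic
closure of `ℚ_p` with its (unique) extension of the `p`-adic absolute value is modelled by an
algebraically closed normed field `L`, algebraic over `ℚ_p`, whose norm restricts to the
`p`-adic norm on `ℚ_p`. -/
theorem stmt1 (p : ℕ) [Fact p.Prime] (n : ℕ) (hn : 2 ≤ n)
    (κ : ℝ) (hκ0 : 0 < κ) (hκ1 : κ < 1)
    (L : Type*) [NormedField L] [Algebra ℚ_[p] L] [IsAlgClosed L]
    [Algebra.IsAlgebraic ℚ_[p] L]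
    (hL : ∀ y : ℚ_[p], ‖algebraMap ℚ_[p] L y‖ = ‖y‖)
    (μ : Measure ℚ_[p]) [μ.IsAddHaarMeasure]
    (hμ : μ {x : ℚ_[p] | ‖x‖ ≤ 1} = 1) :
    ∃ C₀ C₁ C₂ : ℝ, 0 < C₀ ∧ 0 < C₁ ∧ 0 < C₂ ∧
      ∀ θ : ℝ, 0 ≤ θ → θ ≤ ((n : ℝ) + 1) / 3 →
      ∀ (x₀ : ℤ_[p]) (r : ℝ), 0 < r → r ≤ 1 →
      ∃ Q₀ : ℝ, ∀ Q : ℝ, Q₀ ≤ Q →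
        ENNReal.ofReal κ * μ {x : ℚ_[p] | ‖x - (x₀ : ℚ_[p])‖ ≤ r} ≤
          μ ((⋃ α ∈ {α : ℚ_[p] | ‖α‖ ≤ 1 ∧ ∃ P : Polynomial ℤ,
                Irreducible P ∧ P.natDegree = n ∧ Polynomial.aeval α P = 0 ∧
                C₁ * Q ≤ (polyHeight P : ℝ) ∧ (polyHeight P : ℝ) ≤ C₂ * Q ∧
                ∃ β : L, Polynomial.aeval β P = 0 ∧ β ≠ algebraMap ℚ_[p] L α ∧
                  ‖algebraMap ℚ_[p] L α - β‖ ≤ C₀ * Q ^ (-θ)},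
              {x : ℚ_[p] | ‖x - α‖ ≤ C₀ * Q ^ (-(n : ℝ) - 1 + 2 * θ)}) ∩
            {x : ℚ_[p] | ‖x - (x₀ : ℚ_[p])‖ ≤ r}) := by
  have hp0 := prime_cast_pos (p := p)
  have hp1 := (one_lt_prime_cast (p := p)).le
  obtain ⟨ε, hε, hmeas⟩ := measure_short_le (p := p) (N := n + 1) μ (by omega)
    (η := ENNReal.ofReal (1 - κ)) (by simpa using hκ1)
  obtain ⟨K, c, C, hK, hc, hC, hgood⟩ := exists_good_polynomial p hn hε
  have hK' : (0 : ℝ) < K := by exact_mod_cast hK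
  have hn0 : (1 : ℝ) ≤ n := by exact_mod_cast (by omega : 1 ≤ n)
  refine ⟨n * K ^ 2 * p ^ (K ^ 3 + 1), c / p, C, by positivity, by positivity, hC,
    fun θ hθ hθn x₀ r hr hr1 => ?_⟩
  obtain ⟨j, hj⟩ := exists_setOf_norm_sub_le_eq_pball (x₀ : ℚ_[p]) hr hr1
  obtain ⟨T₀, hT₀⟩ := hmeas x₀ j (PadicInt.norm_le_one x₀)
  refine ⟨max (p * T₀) (p ^ (K ^ 3)), fun Q hQ => ?_⟩
  obtain ⟨a, b, T, hT, hTp, hQT, hTQ, hab, hQb, hbQ, hQN⟩ := exists_parameters (p := p)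
    (N := n + 1) (by omega) (K ^ 3) hθ (by push_cast; exact hθn) ((le_max_right _ _).trans hQ)
  have hQ0 : 0 < Q := (by positivity : (0 : ℝ) < (p : ℝ) ^ K ^ 3).trans_le
    ((le_max_right _ _).trans hQ)
  have hbad := hT₀ a b T ((by
    rw [le_div_iff₀ hp0, mul_comm]; exact (le_max_left _ _).trans hQ :
      T₀ ≤ Q / p).trans hQT) hTp (by omega)
  rw [hj]
  refine ENNReal.mul_le_of_le_mul_add hκ0.le hκ1.le ?_ hbad
    ((measure_mono fun y hy => ?_).trans (measure_union_le _ _))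
  · exact (isCompact_closedBall _ _).measure_lt_top.ne
  by_cases hyb : ∃ v : Fin (n + 1) → ℤ, v ≠ 0 ∧ (∀ i, |(v i : ℝ)| ≤ ε * T) ∧ IsShort a b y v
  · exact Or.inl ⟨hy, hyb⟩
  refine Or.inr ⟨?_, hy⟩
  have hy1 : ‖y‖ ≤ 1 := by
    rw [← hj] at hy
    have h1 := IsUltrametricDist.norm_add_le_max (y - x₀) (x₀ : ℚ_[p])
    rw [sub_add_cancel] at h1
    exact h1.trans (max_le (le_trans hy hr1) (PadicInt.norm_le_one x₀))
  push Not at hyb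
  obtain ⟨F, hirr, hdeg, hlow, hupp, h0, h1, h1', h2⟩ := hgood ⟨y, hy1⟩ a b T hT hTp hyb
  have hKab : (K : ℝ) ^ 3 * p ^ (2 * b) < p ^ a := by
    have h3 : (K : ℝ) ^ 3 < (p : ℝ) ^ (K ^ 3) := by
      exact_mod_cast Nat.lt_pow_self (Fact.out : p.Prime).one_lt
    calc (K : ℝ) ^ 3 * p ^ (2 * b) < p ^ (K ^ 3) * p ^ (2 * b) := by gcongr
      _ = p ^ (2 * b + K ^ 3) := by rw [← pow_add, add_comm]
      _ ≤ p ^ a := pow_le_pow_right₀ hp1 hab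
  obtain ⟨α, hα, hdist, β, hβ, hβα, hβle⟩ := exists_close_roots hL hK h0 h1 h1' h2 hKab
  rw [hdeg] at hβle
  simp only [Set.mem_iUnion]
  refine ⟨α, ⟨PadicInt.norm_le_one α, F, hirr, hdeg, hα, ?_, ?_, β, hβ, hβα, ?_⟩, ?_⟩
  · refine le_trans ?_ hlow
    rw [div_mul_eq_mul_div, mul_div_assoc]
    gcongr
  · exact hupp.trans (by gcongr)
  · refine hβle.trans ?_
    have h3 : 1 ≤ p ^ (K ^ 3 + 1) * (Q ^ θ)⁻¹ * p ^ b := by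
      rw [mul_right_comm, ← pow_add, ← div_eq_mul_inv, one_le_div (by positivity)]
      rwa [show K ^ 3 + 1 + b = b + K ^ 3 + 1 by ring]
    rw [Real.rpow_neg hQ0.le, div_le_iff₀ (by positivity)]
    calc (n : ℝ) * K ^ 2 ≤ n * K ^ 2 * (p ^ (K ^ 3 + 1) * (Q ^ θ)⁻¹ * p ^ b) :=
          le_mul_of_one_le_right (by positivity) h3
      _ = _ := by ring
  · change ‖y - α‖ ≤ _
    have hdist' : ‖y - α‖ ≤ K ^ 2 * p ^ b / p ^ a := hdist
    refine hdist'.trans ?_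
    have e1 : Q ^ (-(n : ℝ) - 1 + 2 * θ) = Q ^ θ * Q ^ θ / Q ^ (n + 1) := by
      rw [← Real.rpow_add hQ0, ← Real.rpow_natCast, ← Real.rpow_sub hQ0]
      congr 1; push_cast; ring
    have e2 : (K : ℝ) ^ 2 * p ^ b / p ^ a = K ^ 2 * p * (p ^ b * p ^ b) / p ^ (a + b + 1) := by
      field_simp
      ring
    rw [e1, e2, mul_div_assoc]
    have h4 : (K : ℝ) ^ 2 * p ≤ n * K ^ 2 * p ^ (K ^ 3 + 1) := by
      refine mul_le_mul (le_mul_of_one_le_left (by positivity) hn0) ?_ hp0.le (by positivity)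
      exact le_self_pow₀ hp1 (by omega)
    gcongr
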